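/- arXiv:1206.6811 — 5 statements merged into one kernel-verified Lean document; each statement's English description precedes it below -/
import Mathlib

section
/- Let A = {a_1, a_2, ...} be a countably infinite set, let X be a discrete random variable taking values in the finite set {a_1, ..., a_m} (for some m ∈ ℕ), and let Y be a discrete random variable taking values in A. Suppose d_TV(P_X, P_Y) ≤ η for some η ∈ [0,1), let M be an integer with M ≥ m+1 and M ≥ 1/(1−η), and suppose that −Σ_{i=M}^∞ P_Y(a_i)·log P_Y(a_i) ≤ μ for some μ > 0. Then |H(X) − H(Y)| ≤ η·log(M−1) + h(η) + μ. -/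
/-- The entropy (in nats) of a probability mass function on a countable set. -/
noncomputable def entropyPmf (P : ℕ → ℝ) : ℝ := -∑' k, P k * Real.log (P k)

/-- The total variation distance between two probability mass functions. -/
noncomputable def tvDist {α : Type*} (P Q : α → ℝ) : ℝ := (1 / 2) * ∑' x, |P x - Q x|

/-- The binary entropy function (in nats). -/
noncomputable def binEnt (x : ℝ) : ℝ := -(x * Real.log x) - (1 - x) * Real.log (1 - x)

open Real in
/-- Gibbs' inequality for a single term. -/
lemma negMulLog_le_neg_mul_log_add {a c : ℝ} (ha : 0 ≤ a) (hc : 0 < c) :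
    negMulLog a ≤ -(a * log c) + c - a := by
  rcases ha.eq_or_lt with rfl | ha
  · simp [hc.le]
  · have h := log_le_sub_one_of_pos (div_pos hc ha)
    rw [log_div hc.ne' ha.ne'] at h
    have h2 := mul_le_mul_of_nonneg_left h ha.le
    have h3 : a * (c / a - 1) = c - a := by field_simp
    rw [negMulLog]
    nlinarith

open Real in
lemma neg_mul_log_le_negMulLog {a c : ℝ} (ha : 0 ≤ a) (hac : a ≤ c) :
    -(a * log c) ≤ negMulLog a := by
  rcases ha.eq_or_lt with rfl | ha
  · simp
  · have := mul_le_mul_of_nonneg_left (log_le_log ha hac) ha.le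
    rw [negMulLog]
    linarith

open Real in
lemma negMulLog_add_le {a b : ℝ} (ha : 0 ≤ a) (hb : 0 ≤ b) :
    negMulLog (a + b) ≤ negMulLog a + negMulLog b := by
  have h1 := neg_mul_log_le_negMulLog ha (le_add_of_nonneg_right hb)
  have h2 := neg_mul_log_le_negMulLog hb (le_add_of_nonneg_left ha)
  have h3 : negMulLog (a + b) = -(a * log (a + b)) + -(b * log (a + b)) := by
    rw [negMulLog]; ring
  linarith

open Real in
lemma negMulLog_add_negMulLog_le {a b d : ℝ} (ha : 0 ≤ a) (hb : 0 ≤ b) (hd0 : 0 < d)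
    (hd1 : d < 1) :
    negMulLog a + negMulLog b ≤ negMulLog (a + b) - a * log (1 - d) - b * log d := by
  rcases (add_nonneg ha hb).eq_or_lt with hs | hs
  · obtain rfl : a = 0 := by linarith
    obtain rfl : b = 0 := by linarith
    simp
  · have hd : 0 < 1 - d := by linarith
    have h1 := negMulLog_le_neg_mul_log_add ha (mul_pos hs hd)
    have h2 := negMulLog_le_neg_mul_log_add hb (mul_pos hs hd0)
    rw [log_mul hs.ne' hd.ne'] at h1
    rw [log_mul hs.ne' hd0.ne'] at h2
    rw [negMulLog.eq_def (a + b)]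
    nlinarith

open Real Finset in
/-- On a set of `k` points, a nonnegative function of total mass `d` has entropy at most
`d log (k / d)`. -/
lemma sum_negMulLog_le {ι : Type*} (s : Finset ι) (f : ι → ℝ) (hf : ∀ i ∈ s, 0 ≤ f i) {d : ℝ}
    (hd : 0 < d) (hsum : ∑ i ∈ s, f i = d) :
    ∑ i ∈ s, negMulLog (f i) ≤ d * log #s + negMulLog d := by
  have hk : (0 : ℝ) < #s := by
    rcases s.eq_empty_or_nonempty with rfl | h
    · simp at hsum; linarith
    · exact_mod_cast h.card_pos
  calc ∑ i ∈ s, negMulLog (f i)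
      ≤ ∑ i ∈ s, (-(f i * log (d / #s)) + d / #s - f i) :=
        sum_le_sum fun i hi => negMulLog_le_neg_mul_log_add (hf i hi) (div_pos hd hk)
    _ = d * log #s + negMulLog d := by
        rw [sum_sub_distrib, sum_add_distrib, sum_neg_distrib, ← sum_mul, hsum, sum_const,
          nsmul_eq_mul, log_div hd.ne' hk.ne', negMulLog]
        field_simp
        ring

open Real Finset in
/-- Zhang's inequality: continuity of entropy in total variation on a finite set. -/
lemma sum_negMulLog_sub_le {ι : Type*} [DecidableEq ι] (s : Finset ι) (P Q : ι → ℝ)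
    (hP : ∀ i ∈ s, 0 ≤ P i) (hQ : ∀ i ∈ s, 0 ≤ Q i)
    (hPs : ∑ i ∈ s, P i = 1) (hQs : ∑ i ∈ s, Q i = 1) {d : ℝ}
    (hd : ∑ i ∈ s, |P i - Q i| = 2 * d) (hd1 : d < 1) :
    ∑ i ∈ s, negMulLog (P i) - ∑ i ∈ s, negMulLog (Q i) ≤ qaryEntropy #s d := by
  have hd0 : 0 ≤ d := by
    have : 0 ≤ ∑ i ∈ s, |P i - Q i| := sum_nonneg fun i _ => abs_nonneg _
    linarith
  rcases hd0.eq_or_lt with rfl | hd0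
  · have h : ∀ i ∈ s, |P i - Q i| = 0 :=
      (sum_eq_zero_iff_of_nonneg fun i _ => abs_nonneg _).1 (by simpa using hd)
    have h' : ∑ i ∈ s, negMulLog (P i) = ∑ i ∈ s, negMulLog (Q i) :=
      sum_congr rfl fun i hi => by rw [sub_eq_zero.1 (abs_eq_zero.1 (h i hi))]
    simp [h']
  set w : ι → ℝ := fun i => min (P i) (Q i) with hw
  set A : ι → ℝ := fun i => P i - w i with hA
  set B : ι → ℝ := fun i => Q i - w i with hB
  have hw0 : ∀ i ∈ s, 0 ≤ w i := fun i hi => le_min (hP i hi) (hQ i hi)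
  have hA0 : ∀ i, 0 ≤ A i := fun i => sub_nonneg.2 (min_le_left _ _)
  have hB0 : ∀ i, 0 ≤ B i := fun i => sub_nonneg.2 (min_le_right _ _)
  have habs : ∀ i, |P i - Q i| = P i + Q i - 2 * w i := fun i => by
    rcases le_total (P i) (Q i) with h | h
    · simp only [hw, min_eq_left h]; rw [abs_of_nonpos (by linarith)]; ring
    · simp only [hw, min_eq_right h]; rw [abs_of_nonneg (by linarith)]; ring
  have hws : ∑ i ∈ s, w i = 1 - d := by
    simp only [habs, sum_sub_distrib, sum_add_distrib, ← mul_sum, hPs, hQs] at hd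
    linarith
  have hAs : ∑ i ∈ s, A i = d := by simp only [hA, sum_sub_distrib, hPs, hws]; ring
  have hBs : ∑ i ∈ s, B i = d := by simp only [hB, sum_sub_distrib, hQs, hws]; ring
  have hPle : ∑ i ∈ s, negMulLog (P i) ≤ ∑ i ∈ s, negMulLog (w i) + ∑ i ∈ s, negMulLog (A i) := by
    rw [← sum_add_distrib]
    refine sum_le_sum fun i hi => ?_
    have := negMulLog_add_le (hw0 i hi) (hA0 i)
    simpa [hA] using this
  have hQge : ∑ i ∈ s, negMulLog (w i) + ∑ i ∈ s, negMulLog (B i)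
      ≤ ∑ i ∈ s, negMulLog (Q i) + binEntropy d := by
    have h1 : ∑ i ∈ s, (negMulLog (w i) + negMulLog (B i))
        ≤ ∑ i ∈ s, (negMulLog (Q i) - w i * log (1 - d) - B i * log d) := by
      refine sum_le_sum fun i hi => ?_
      have := negMulLog_add_negMulLog_le (hw0 i hi) (hB0 i) hd0 hd1
      rwa [show w i + B i = Q i by simp [hB]] at this
    rw [sum_add_distrib, sum_sub_distrib, sum_sub_distrib, ← sum_mul, ← sum_mul, hws, hBs] at h1
    rw [binEntropy_eq_negMulLog_add_negMulLog_one_sub, negMulLog, negMulLog]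
    linarith
  have hBge : negMulLog d ≤ ∑ i ∈ s, negMulLog (B i) := by
    calc negMulLog d = ∑ i ∈ s, -(B i * log d) := by
          rw [sum_neg_distrib, ← sum_mul, hBs, negMulLog]; ring
      _ ≤ _ := sum_le_sum fun i hi => neg_mul_log_le_negMulLog (hB0 i)
          (hBs ▸ single_le_sum (fun j _ => hB0 j) hi)
  obtain ⟨b, hb, hbpos⟩ : ∃ b ∈ s, 0 < B b := exists_lt_of_sum_lt (by simpa [hBs] using hd0)
  have hAb : A b = 0 := by
    simp only [hA, hB, hw] at hbpos ⊢
    rcases le_total (P b) (Q b) with h | h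
    · simp [h]
    · simp [h] at hbpos
  have hAle : ∑ i ∈ s, negMulLog (A i) ≤ d * log ((#s : ℤ) - 1 : ℤ) + negMulLog d := by
    have h := sum_negMulLog_le (s.erase b) A (fun i _ => hA0 i) hd0
      (by rw [sum_erase _ hAb, hAs])
    rw [sum_erase _ (by simp [hAb]), card_erase_of_mem hb,
      Nat.cast_sub (card_pos.2 ⟨b, hb⟩)] at h
    simpa using h
  rw [qaryEntropy]
  linarith

open Real in
lemma negMulLog_tsum_le {f : ℕ → ℝ} (hf : ∀ i, 0 ≤ f i) (hs : Summable f)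
    (hl : Summable fun i => f i * log (f i)) :
    negMulLog (∑' i, f i) ≤ -∑' i, f i * log (f i) := by
  rw [negMulLog, neg_mul, neg_le_neg_iff, ← tsum_mul_right]
  refine hl.tsum_le_tsum (fun i => ?_) (hs.mul_right _)
  have := neg_mul_log_le_negMulLog (hf i) (hs.le_tsum i fun j _ => hf j)
  rw [negMulLog] at this
  linarith

/-- The countably infinite set `A = {a_1, a_2, ...}` is identified with
`{1, 2, 3, ...} ⊆ ℕ` (via `a_i ↔ i`), so probability mass functions on `A` are functions
`ℕ → ℝ` vanishing at `0`.  `X` takes values in `{a_1, ..., a_m}`, `Y` takes values in `A`,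
`d_TV(P_X, P_Y) ≤ η` for some `η ∈ [0,1)`, `M` is an integer with `M ≥ m + 1` and
`M ≥ 1/(1-η)`, and the tail entropy `-∑_{i=M}^∞ P_Y(a_i) log P_Y(a_i)` is (convergent and)
at most `μ₀ > 0`.  Then `|H(X) - H(Y)| ≤ η log(M-1) + h(η) + μ₀`. -/
theorem entropy_difference_of_tv_bound
    (PX PY : ℕ → ℝ)
    (hPXnn : ∀ i, 0 ≤ PX i) (hPXsum : ∑' i, PX i = 1)
    (hPYnn : ∀ i, 0 ≤ PY i) (hPYsum : ∑' i, PY i = 1)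
    (hPX0 : PX 0 = 0) (hPY0 : PY 0 = 0)
    (m : ℕ) (hPXfin : ∀ i, m < i → PX i = 0)
    (η : ℝ) (hη0 : 0 ≤ η) (hη1 : η < 1)
    (hTV : tvDist PX PY ≤ η)
    (M : ℕ) (hM1 : m + 1 ≤ M) (hM2 : 1 / (1 - η) ≤ (M : ℝ))
    (μ₀ : ℝ) (hμpos : 0 < μ₀)
    (htailsum : Summable (fun i : ℕ => if M ≤ i then PY i * Real.log (PY i) else 0))
    (htail : -∑' i : ℕ, (if M ≤ i then PY i * Real.log (PY i) else 0) ≤ μ₀) :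
    |entropyPmf PX - entropyPmf PY| ≤ η * Real.log ((M : ℝ) - 1) + binEnt η + μ₀ := by
  have hXs : Summable PX := by
    by_contra h
    simp [tsum_eq_zero_of_not_summable h] at hPXsum
  have hYs : Summable PY := by
    by_contra h
    simp [tsum_eq_zero_of_not_summable h] at hPYsum
  have hX0 : ∀ i, M ≤ i → PX i = 0 := fun i hi => hPXfin i (by omega)
  have hM : 2 ≤ M := by
    by_contra h
    have h0 : ∀ i, PX i = 0 := fun i => by
      rcases Nat.eq_zero_or_pos i with rfl | hi
      · exact hPX0
      · exact hPXfin i (by omega)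
    simp [h0] at hPXsum
  set T : ℝ := ∑' i, PY (i + M) with hT
  have hYsplit : ∑ i ∈ Finset.range M, PY i + T = 1 := by
    rw [hT, hYs.sum_add_tsum_nat_add, hPYsum]
  have hYsT : Summable fun i => PY (i + M) := (summable_nat_add_iff M).2 hYs
  have hT0 : 0 ≤ T := tsum_nonneg fun i => hPYnn _
  have hT1 : T ≤ 1 := by
    have : 0 ≤ ∑ i ∈ Finset.range M, PY i := Finset.sum_nonneg fun i _ => hPYnn i
    linarith
  have hlT : Summable fun i => PY (i + M) * Real.log (PY (i + M)) := by
    simpa using (summable_nat_add_iff M).2 htailsum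
  have hl : Summable fun i => PY i * Real.log (PY i) :=
    (summable_nat_add_iff (f := fun i => PY i * Real.log (PY i)) M).1 hlT
  have htail' : -∑' i, PY (i + M) * Real.log (PY (i + M)) ≤ μ₀ := by
    rw [← htailsum.sum_add_tsum_nat_add M, Finset.sum_eq_zero (fun i hi => by
      simp [Finset.mem_range.1 hi])] at htail
    simpa using htail
  have hTent := negMulLog_tsum_le (fun i => hPYnn (i + M)) hYsT hlT
  rw [← hT] at hTent
  have hTnn := Real.negMulLog_nonneg hT0 hT1
  -- `R` merges all atoms of `Y` with index at least `M` into one.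
  set R : ℕ → ℝ := fun i => if i < M then PY i else T with hR
  set s := (Finset.range (M + 1)).erase 0 with hs
  have hcard : s.card = M := by simp [hs]
  have hsum : ∀ f : ℕ → ℝ, f 0 = 0 → ∑ i ∈ s, f i = ∑ i ∈ Finset.range M, f i + f M := by
    intro f hf
    rw [hs, Finset.sum_erase _ hf, Finset.sum_range_succ]
  have hR0 : R 0 = 0 := by simp [hR, hPY0, show M ≠ 0 by omega]
  have hRM : R M = T := by simp [hR]
  have hRlt : ∀ i ∈ Finset.range M, R i = PY i := fun i hi => by
    simp [hR, Finset.mem_range.1 hi]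
  have hRnn : ∀ i, 0 ≤ R i := fun i => by
    simp only [hR]; split_ifs
    exacts [hPYnn i, hT0]
  have hPXs : ∑ i ∈ s, PX i = 1 := by
    rw [hsum _ hPX0, hX0 M le_rfl, add_zero, ← hPXsum]
    exact (tsum_eq_sum fun i hi => hX0 i (by simpa using hi)).symm
  have hRs : ∑ i ∈ s, R i = 1 := by
    rw [hsum _ hR0, hRM, Finset.sum_congr rfl hRlt, hYsplit]
  have hHX : entropyPmf PX = ∑ i ∈ s, Real.negMulLog (PX i) := by
    rw [hsum _ (by simp [hPX0]), hX0 M le_rfl, entropyPmf,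
      tsum_eq_sum (s := Finset.range M) fun i hi => by simp [hX0 i (by simpa using hi)],
      ← Finset.sum_neg_distrib]
    simp [Real.negMulLog]
  have hHR : ∑ i ∈ s, Real.negMulLog (R i)
      = ∑ i ∈ Finset.range M, Real.negMulLog (PY i) + Real.negMulLog T := by
    rw [hsum _ (by simp [hR0]), hRM]
    congr 1
    exact Finset.sum_congr rfl fun i hi => by rw [hRlt i hi]
  have hHY : entropyPmf PY = ∑ i ∈ Finset.range M, Real.negMulLog (PY i)
      + -∑' i, PY (i + M) * Real.log (PY (i + M)) := by
    rw [entropyPmf, ← hl.sum_add_tsum_nat_add M, neg_add, ← Finset.sum_neg_distrib]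
    simp [Real.negMulLog]
  set d := tvDist PX PY with hd
  have hds : ∑ i ∈ s, |PX i - R i| = 2 * d := by
    have habs : Summable fun i => |PX i - PY i| := (hXs.sub hYs).abs
    have htl : ∑' i, |PX (i + M) - PY (i + M)| = T := by
      refine tsum_congr fun i => ?_
      rw [hX0 _ (by omega), zero_sub, abs_neg, abs_of_nonneg (hPYnn _)]
    rw [hsum _ (by simp [hPX0, hR0]), hRM, hX0 M le_rfl, zero_sub, abs_neg, abs_of_nonneg hT0,
      Finset.sum_congr rfl fun i hi => by rw [hRlt i hi], hd, tvDist,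
      ← habs.sum_add_tsum_nat_add M, htl]
    ring
  have hd0 : 0 ≤ d := by
    have : 0 ≤ ∑ i ∈ s, |PX i - R i| := Finset.sum_nonneg fun i _ => abs_nonneg _
    linarith
  have hd1 : d < 1 := hTV.trans_lt hη1
  have h1 := sum_negMulLog_sub_le s PX R (fun i _ => hPXnn i) (fun i _ => hRnn i) hPXs hRs hds hd1
  have h2 := sum_negMulLog_sub_le s R PX (fun i _ => hRnn i) (fun i _ => hPXnn i) hRs hPXs
    (by simpa only [abs_sub_comm] using hds) hd1
  rw [hcard] at h1 h2
  have hηM : η ≤ 1 - 1 / (M : ℝ) := by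
    have hMpos : (0 : ℝ) < M := by positivity
    have : 1 / (M : ℝ) ≤ 1 - η := (one_div_le (by linarith) hMpos).1 hM2
    linarith
  have hmono : Real.qaryEntropy M d ≤ Real.qaryEntropy M η :=
    (Real.qaryEntropy_strictMonoOn hM).monotoneOn ⟨hd0, hTV.trans hηM⟩ ⟨hη0, hηM⟩ hTV
  have hq : Real.qaryEntropy M η = η * Real.log ((M : ℝ) - 1) + binEnt η := by
    rw [Real.qaryEntropy, Real.binEntropy_eq_negMulLog_add_negMulLog_one_sub, binEnt,
      Real.negMulLog, Real.negMulLog]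
    push_cast
    ring
  rw [abs_le]
  constructor <;> linarith
end

section
/- Let Y be a discrete random variable taking values in a countably infinite set A = {a_1, a_2, ...}, let M ≥ 1 be an integer, and define the random variable Ỹ by Ỹ = Y if Y ∈ {a_1, ..., a_{M−1}} and Ỹ = a_M otherwise. Then 0 ≤ H(Y) − H(Ỹ) ≤ −Σ_{i=M}^∞ P_Y(a_i)·log P_Y(a_i). Moreover, if X is a discrete random variable taking values in {a_1, ..., a_m} with m ≤ M−1, then d_TV(P_X, P_Ỹ) = d_TV(P_X, P_Y). -/
open MeasureTheory

/-- The law of `min Y M` when `Y` has law `p`: all the mass of `[M, ∞)` is moved to `M`. -/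
noncomputable def truncatePmf (p : ℕ → ℝ) (M i : ℕ) : ℝ :=
  if i < M then p i else if i = M then ∑' j, p (j + M) else 0

lemma tsum_truncate {f : ℕ → ℝ} {M : ℕ} (hf : ∀ i, M < i → f i = 0) :
    ∑' i, f i = ∑ i ∈ Finset.range M, f i + f M := by
  rw [← Finset.sum_range_succ]
  exact tsum_eq_sum fun i hi ↦ hf i (by simpa using hi)

lemma tsum_ite_le {f : ℕ → ℝ} (hf : Summable f) (M : ℕ) :
    ∑' i, (if M ≤ i then f i else 0) = ∑' j, f (j + M) := by
  have hg : Summable fun i ↦ if M ≤ i then f i else 0 := by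
    rw [← summable_nat_add_iff M]
    simpa using (summable_nat_add_iff M).mpr hf
  rw [← hg.sum_add_tsum_nat_add M, Finset.sum_eq_zero, zero_add]
  · simp
  · intro i hi
    simp [Finset.mem_range.mp hi]

lemma entropyPmf_sub_entropyPmf_truncatePmf {p : ℕ → ℝ}
    (hent : Summable fun i ↦ p i * Real.log (p i)) (M : ℕ) :
    entropyPmf p - entropyPmf (truncatePmf p M) =
      (∑' j, p (j + M)) * Real.log (∑' j, p (j + M)) -
        ∑' j, p (j + M) * Real.log (p (j + M)) := by
  have hq : ∑ i ∈ Finset.range M, truncatePmf p M i * Real.log (truncatePmf p M i) =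
      ∑ i ∈ Finset.range M, p i * Real.log (p i) :=
    Finset.sum_congr rfl fun i hi ↦ by simp [truncatePmf, Finset.mem_range.mp hi]
  rw [entropyPmf, entropyPmf, ← hent.sum_add_tsum_nat_add M, tsum_truncate (f := fun i ↦ truncatePmf p M i * _) (M := M), hq]
  · simp only [truncatePmf, lt_irrefl, if_true, if_false]
    ring
  · intro i hi
    simp [truncatePmf, hi.not_gt, hi.ne']

lemma tsum_mul_log_le {ι : Type*} {f : ι → ℝ} (h0 : ∀ i, 0 ≤ f i) (hf : Summable f)
    (hent : Summable fun i ↦ f i * Real.log (f i)) :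
    ∑' i, f i * Real.log (f i) ≤ (∑' i, f i) * Real.log (∑' i, f i) := by
  rw [← tsum_mul_right]
  refine hent.tsum_le_tsum (fun i ↦ ?_) (hf.mul_right _)
  rcases (h0 i).eq_or_lt with h | h
  · simp [← h]
  · exact mul_le_mul_of_nonneg_left
      (Real.log_le_log h (hf.le_tsum i fun j _ ↦ h0 j)) (h0 i)

lemma tvDist_truncatePmf {r p : ℕ → ℝ} {M : ℕ} (hr : ∀ i, M ≤ i → r i = 0)
    (h0 : ∀ i, 0 ≤ p i) (hp : Summable p) :
    tvDist r (truncatePmf p M) = tvDist r p := by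
  have htail : ∀ j, |r (j + M) - p (j + M)| = p (j + M) := fun j ↦ by
    rw [hr _ (Nat.le_add_left M j), zero_sub, abs_neg, abs_of_nonneg (h0 _)]
  have hsum : Summable fun i ↦ |r i - p i| := by
    rw [← summable_nat_add_iff M]
    simpa only [htail] using (summable_nat_add_iff M).mpr hp
  have hq : ∑ i ∈ Finset.range M, |r i - truncatePmf p M i| =
      ∑ i ∈ Finset.range M, |r i - p i| :=
    Finset.sum_congr rfl fun i hi ↦ by simp [truncatePmf, Finset.mem_range.mp hi]
  rw [tvDist, tvDist, ← hsum.sum_add_tsum_nat_add M, tsum_truncate (M := M), hq]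
  · simp only [htail, truncatePmf, lt_irrefl, if_true, if_false, hr M le_rfl, zero_sub, abs_neg]
    rw [abs_of_nonneg (tsum_nonneg fun j ↦ h0 (j + M))]
  · intro i hi
    simp [truncatePmf, hi.not_gt, hi.ne', hr i hi.le]

lemma hasSum_measureReal_fiber {Ω : Type*} [MeasurableSpace Ω] (μ : Measure Ω)
    [IsFiniteMeasure μ] {Y : Ω → ℕ} (hY : Measurable Y) (M : ℕ) :
    HasSum (fun j ↦ μ.real {ω | Y ω = j + M}) (μ.real {ω | M ≤ Y ω}) := by
  have hU : {ω | M ≤ Y ω} = ⋃ j, {ω | Y ω = j + M} := by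
    ext ω
    simp [le_iff_exists_add']
  have hd : Pairwise (Function.onFun Disjoint fun j ↦ {ω | Y ω = j + M}) := fun i j hij ↦
    Set.disjoint_left.mpr fun ω (hi : Y ω = i + M) (hj : Y ω = j + M) ↦ hij (by omega)
  have hm := measure_iUnion (μ := μ) hd fun j ↦ hY (measurableSet_singleton (j + M))
  rw [← hU] at hm
  have htop : ∑' j, μ {ω | Y ω = j + M} ≠ ⊤ := hm ▸ measure_ne_top μ _
  rw [Measure.real, hm, ENNReal.tsum_toReal_eq fun j ↦ measure_ne_top μ _]
  exact ENNReal.hasSum_toReal htop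

/-- The countably infinite set `A = {a_1, a_2, ...}` is identified with
`{1, 2, 3, ...} ⊆ ℕ` (via `a_i ↔ i`).  `Y` is a discrete random variable with values in `A`,
`M ≥ 1` is an integer, and `Ỹ = Y` if `Y ∈ {a_1, ..., a_{M-1}}` (i.e. `Y < M`) and `Ỹ = a_M`
otherwise.  Then `0 ≤ H(Y) - H(Ỹ) ≤ -∑_{i=M}^∞ P_Y(a_i) log P_Y(a_i)` (assuming the
entropy series of `Y` converges); moreover, for any discrete random variable `X` with values
in `{a_1, ..., a_m}` with `m ≤ M - 1`, one has `d_TV(P_X, P_Ỹ) = d_TV(P_X, P_Y)`. -/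
theorem entropy_and_tv_of_truncation
    {Ω : Type*} [MeasurableSpace Ω] (μ : Measure Ω) [IsProbabilityMeasure μ]
    (Y : Ω → ℕ) (hYmeas : Measurable Y) (hYval : ∀ ω, 1 ≤ Y ω)
    (M : ℕ) (hM : 1 ≤ M)
    (Yt : Ω → ℕ) (hYt : ∀ ω, Yt ω = if Y ω < M then Y ω else M)
    (PY PYt : ℕ → ℝ)
    (hPY : ∀ i, PY i = (μ {ω | Y ω = i}).toReal)
    (hPYt : ∀ i, PYt i = (μ {ω | Yt ω = i}).toReal)
    (hent : Summable fun i : ℕ => PY i * Real.log (PY i)) :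
    (0 ≤ entropyPmf PY - entropyPmf PYt ∧
      entropyPmf PY - entropyPmf PYt ≤
        -∑' i : ℕ, (if M ≤ i then PY i * Real.log (PY i) else 0)) ∧
    ∀ {Ω' : Type*} [MeasurableSpace Ω'] (μ' : Measure Ω') [IsProbabilityMeasure μ']
      (X : Ω' → ℕ) (_ : Measurable X) (m : ℕ) (_ : m < M)
      (_ : ∀ ω', 1 ≤ X ω' ∧ X ω' ≤ m)
      (PX : ℕ → ℝ) (_ : ∀ i, PX i = (μ' {ω' | X ω' = i}).toReal),
      tvDist PX PYt = tvDist PX PY := by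
  obtain rfl : PY = fun i ↦ μ.real {ω | Y ω = i} := funext hPY
  have hp : Summable fun i ↦ μ.real {ω | Y ω = i} := (hasSum_measureReal_fiber μ hYmeas 0).summable
  have htail := hasSum_measureReal_fiber μ hYmeas M
  obtain rfl : PYt = truncatePmf (fun i ↦ μ.real {ω | Y ω = i}) M := by
    funext i
    rw [hPYt, truncatePmf, htail.tsum_eq]
    split_ifs with h1 h2
    · congr 2; ext ω
      simp only [hYt, Set.mem_ofPred_eq]
      grind
    · congr 2; ext ω
      simp only [hYt, Set.mem_ofPred_eq]
      grind
    · have : {ω | Yt ω = i} = ∅ := by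
        ext ω
        simp only [hYt, Set.mem_ofPred_eq, Set.mem_empty_iff_false]
        grind
      simp [this]
  refine ⟨?_, fun μ' _ X _ m hm hX PX hPX ↦
    tvDist_truncatePmf (fun i hi ↦ ?_) (fun _ ↦ measureReal_nonneg) hp⟩
  · rw [entropyPmf_sub_entropyPmf_truncatePmf hent, tsum_ite_le hent]
    have hlow := tsum_mul_log_le (fun _ ↦ measureReal_nonneg) htail.summable
      ((summable_nat_add_iff M).mpr hent)
    have hup : (∑' j, μ.real {ω | Y ω = j + M}) * Real.log (∑' j, μ.real {ω | Y ω = j + M}) ≤ 0 := by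
      rw [htail.tsum_eq]
      exact mul_nonpos_of_nonneg_of_nonpos measureReal_nonneg
        (Real.log_nonpos measureReal_nonneg measureReal_le_one)
    constructor <;> linarith
  · have : {ω' | X ω' = i} = ∅ := by
      ext ω'
      simp only [Set.mem_ofPred_eq, Set.mem_empty_iff_false]
      grind
    simp [hPX, this]
end

section
/- Let I be a finite index set with |I| = n, and let {X_α}_{α∈I} be (possibly dependent) Bernoulli random variables with p_α = P(X_α = 1) > 0 for every α ∈ I. Let W = Σ_{α∈I} X_α and λ = Σ_{α∈I} p_α ∈ (0,∞). For each α ∈ I let B_α ⊆ I be a set with α ∈ B_α, and define b1 = Σ_{α∈I} Σ_{β∈B_α} p_α·p_β, b2 = Σ_{α∈I} Σ_{β∈B_α, β≠α} E[X_α·X_β], and b3 = Σ_{α∈I} E| E[X_α − p_α | σ(X_β : β ∈ I∖B_α)] |. Set η = (b1+b2)·(1−e^{−λ})/λ + b3·min{1, 1.4/√λ} and assume η < 1. Let M be an integer with M ≥ n+2 and M ≥ 1/(1−η). Then |H(Po(λ)) − H(W)| ≤ η·log(M−1) + h(η) + μ(λ,M). -/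
open MeasureTheory ProbabilityTheory

/-- The Poisson probability mass function with mean `lam`. -/
noncomputable def poissonPmf (lam : ℝ) (k : ℕ) : ℝ :=
  Real.exp (-lam) * lam ^ k / (Nat.factorial k)

/-- The quantity `μ(λ, M)`. -/
noncomputable def muBound (lam M : ℝ) : ℝ :=
  (max (lam * Real.log (Real.exp 1 / lam)) 0 + lam ^ 2 +
      (6 * Real.log (2 * Real.pi) + 1) / 12) *
    Real.exp (-(lam + (M - 2) * Real.log ((M - 2) / (lam * Real.exp 1))))

/-- The tangent-line (Gibbs) bound for `x ↦ -x log x`. -/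
theorem negMulLog_le_of_pos {x c : ℝ} (hx : 0 ≤ x) (hc : 0 < c) :
    Real.negMulLog x ≤ -(x * Real.log c) + (c - x) := by
  rcases hx.eq_or_lt with rfl | hx
  · simp [hc.le]
  · have h := Real.log_le_sub_one_of_pos (div_pos hc hx)
    rw [Real.log_div hc.ne' hx.ne'] at h
    have h2 := mul_le_mul_of_nonneg_left h hx.le
    have h3 : x * (c / x - 1) = c - x := by field_simp
    rw [h3] at h2
    simp only [Real.negMulLog]
    nlinarith

theorem negMulLog_add_le_s2 {a v : ℝ} (ha : 0 ≤ a) (hv : 0 ≤ v) :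
    Real.negMulLog (a + v) ≤ Real.negMulLog a + Real.negMulLog v := by
  have key : ∀ a v : ℝ, 0 ≤ a → 0 ≤ v → a * Real.log a ≤ a * Real.log (a + v) := by
    intro a v ha hv
    rcases ha.eq_or_lt with rfl | ha
    · simp
    · exact mul_le_mul_of_nonneg_left (Real.log_le_log ha (by linarith)) ha.le
  have h1 := key a v ha hv
  have h2 := key v a hv ha
  rw [add_comm v a] at h2
  simp only [Real.negMulLog]
  linarith

/-- Entropy is bounded by the logarithm of the number of atoms, for measures of total mass `δ`. -/
theorem sum_negMulLog_le_of_card {ι : Type*} (s : Finset ι) (v : ι → ℝ) (hv : ∀ i ∈ s, 0 ≤ v i)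
    (δ : ℝ) (hδ : 0 < δ) (hsum : ∑ i ∈ s, v i = δ) :
    ∑ i ∈ s, Real.negMulLog (v i) ≤ δ * Real.log s.card + Real.negMulLog δ := by
  have hne : s.Nonempty := by
    by_contra h
    rw [Finset.not_nonempty_iff_eq_empty] at h
    subst h
    simp at hsum
    linarith
  have hcard : (0 : ℝ) < s.card := by exact_mod_cast hne.card_pos
  have hc : 0 < δ / s.card := div_pos hδ hcard
  calc ∑ i ∈ s, Real.negMulLog (v i)
      ≤ ∑ i ∈ s, (-(v i * Real.log (δ / s.card)) + (δ / s.card - v i)) :=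
        Finset.sum_le_sum fun i hi => negMulLog_le_of_pos (hv i hi) hc
    _ = δ * Real.log s.card + Real.negMulLog δ := by
        rw [Finset.sum_add_distrib, Finset.sum_sub_distrib, Finset.sum_neg_distrib,
          ← Finset.sum_mul, hsum, Finset.sum_const, nsmul_eq_mul,
          Real.log_div hδ.ne' hcard.ne', Real.negMulLog]
        field_simp
        ring

/-- Continuity of the entropy on a finite set in total variation distance. -/
theorem sum_negMulLog_sub_le_qaryEntropy {ι : Type*} (s : Finset ι) (p q : ι → ℝ)
    (hp : ∀ i ∈ s, 0 ≤ p i) (hq : ∀ i ∈ s, 0 ≤ q i)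
    (hps : ∑ i ∈ s, p i = 1) (hqs : ∑ i ∈ s, q i = 1)
    (δ : ℝ) (hδ : ∑ i ∈ s, max (q i - p i) 0 = δ) (hδ1 : δ < 1) :
    ∑ i ∈ s, Real.negMulLog (q i) - ∑ i ∈ s, Real.negMulLog (p i) ≤
      Real.qaryEntropy s.card δ := by
  classical
  set a : ι → ℝ := fun i => min (p i) (q i) with ha_def
  set v : ι → ℝ := fun i => max (q i - p i) 0 with hv_def
  have ha : ∀ i ∈ s, 0 ≤ a i := fun i hi => le_min (hp i hi) (hq i hi)
  have hv : ∀ i, 0 ≤ v i := fun i => le_max_right _ _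
  have hav : ∀ i, q i = a i + v i := by
    intro i
    simp only [ha_def, hv_def]
    rcases le_total (p i) (q i) with h | h
    · rw [min_eq_left h, max_eq_left (by linarith)]; ring
    · rw [min_eq_right h, max_eq_right (by linarith)]; ring
  have hasum : ∑ i ∈ s, a i = 1 - δ := by
    have : ∑ i ∈ s, q i = ∑ i ∈ s, a i + ∑ i ∈ s, v i := by
      rw [← Finset.sum_add_distrib]
      exact Finset.sum_congr rfl fun i _ => hav i
    linarith
  have h1 : ∑ i ∈ s, Real.negMulLog (q i) ≤
      ∑ i ∈ s, Real.negMulLog (a i) + ∑ i ∈ s, Real.negMulLog (v i) := by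
    rw [← Finset.sum_add_distrib]
    refine Finset.sum_le_sum fun i hi => ?_
    rw [hav i]
    exact negMulLog_add_le_s2 (ha i hi) (hv i)
  have h2 : ∑ i ∈ s, Real.negMulLog (v i) ≤
      δ * Real.log ((s.card : ℝ) - 1) + Real.negMulLog δ := by
    have hδ0 : 0 ≤ δ := hδ ▸ Finset.sum_nonneg fun i _ => hv i
    rcases hδ0.eq_or_lt with h0 | hpos
    · have hz : ∀ i ∈ s, v i = 0 :=
        (Finset.sum_eq_zero_iff_of_nonneg fun i _ => hv i).1 (hδ.trans h0.symm)
      rw [Finset.sum_congr rfl fun i hi => by rw [hz i hi], ← h0]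
      simp
    · obtain ⟨j, hj, hqp⟩ : ∃ j ∈ s, q j ≤ p j := by
        by_contra! hcon
        have hne : s.Nonempty := by
          by_contra h
          rw [Finset.not_nonempty_iff_eq_empty] at h
          subst h
          simp at hps
        have := Finset.sum_lt_sum_of_nonempty hne hcon
        linarith
      have hvj : v j = 0 := max_eq_right (by linarith)
      have hsum' : ∑ i ∈ s.erase j, v i = δ := by
        rw [← hδ, ← Finset.add_sum_erase s v hj, hvj, zero_add]
      have := sum_negMulLog_le_of_card (s.erase j) v (fun i _ => hv i) δ hpos hsum'
      rw [Finset.card_erase_of_mem hj, Nat.cast_sub (Finset.card_pos.2 ⟨j, hj⟩)] at this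
      rw [← Finset.add_sum_erase s _ hj, hvj, Real.negMulLog_zero, zero_add]
      simpa using this
  have h3 : ∑ i ∈ s, Real.negMulLog (a i) - Real.negMulLog (1 - δ) ≤
      ∑ i ∈ s, Real.negMulLog (p i) := by
    have hp1 : ∀ i ∈ s, p i ≤ 1 := fun i hi => hps ▸ Finset.single_le_sum hp hi
    have hterm : ∀ i ∈ s, Real.negMulLog (a i) + a i * Real.log (1 - δ) -
        (p i * (1 - δ) - a i) ≤ Real.negMulLog (p i) := by
      intro i hi
      have hai := ha i hi
      have hap : a i ≤ p i := min_le_left _ _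
      rcases (hp i hi).eq_or_lt with h0 | hpos
      · have ha0 : a i = 0 := by linarith
        rw [ha0, ← h0]
        simp
      · have hg := negMulLog_le_of_pos hai (mul_pos hpos (sub_pos.2 hδ1))
        rw [Real.log_mul hpos.ne' (sub_pos.2 hδ1).ne'] at hg
        have hlog : Real.log (p i) ≤ 0 := Real.log_nonpos hpos.le (hp1 i hi)
        have : Real.negMulLog (p i) = -(p i * Real.log (p i)) := by simp [Real.negMulLog]
        nlinarith
    have := Finset.sum_le_sum hterm
    rw [Finset.sum_sub_distrib, Finset.sum_add_distrib, Finset.sum_sub_distrib, ← Finset.sum_mul,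
      ← Finset.sum_mul, hasum, hps] at this
    simp only [Real.negMulLog] at this ⊢
    linarith
  rw [Real.qaryEntropy, Real.binEntropy_eq_negMulLog_add_negMulLog_one_sub]
  push_cast
  linarith

/-- Symmetric form of the total variation continuity bound, with an upper bound on the distance. -/
theorem abs_sum_negMulLog_sub_le {ι : Type*} (s : Finset ι) (p q : ι → ℝ)
    (hp : ∀ i ∈ s, 0 ≤ p i) (hq : ∀ i ∈ s, 0 ≤ q i)
    (hps : ∑ i ∈ s, p i = 1) (hqs : ∑ i ∈ s, q i = 1) (hcard : 2 ≤ s.card)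
    (η : ℝ) (hη : ∑ i ∈ s, max (q i - p i) 0 ≤ η) (hη1 : η ≤ 1 - 1 / (s.card : ℝ)) :
    |∑ i ∈ s, Real.negMulLog (p i) - ∑ i ∈ s, Real.negMulLog (q i)| ≤
      Real.qaryEntropy s.card η := by
  have hpos : (0 : ℝ) < 1 / (s.card : ℝ) := by
    have : (0 : ℝ) < s.card := by exact_mod_cast (by omega : 0 < s.card)
    positivity
  have hδ0 : 0 ≤ ∑ i ∈ s, max (q i - p i) 0 := Finset.sum_nonneg fun i _ => le_max_right _ _
  have hsymm : ∑ i ∈ s, max (p i - q i) 0 = ∑ i ∈ s, max (q i - p i) 0 := by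
    rw [← sub_eq_zero, ← Finset.sum_sub_distrib]
    have : ∀ i ∈ s, max (p i - q i) 0 - max (q i - p i) 0 = p i - q i := by
      intro i _
      rcases le_total (p i) (q i) with h | h
      · rw [max_eq_right (by linarith), max_eq_left (by linarith)]; ring
      · rw [max_eq_left (by linarith), max_eq_right (by linarith)]; ring
    rw [Finset.sum_congr rfl this, Finset.sum_sub_distrib, hps, hqs, sub_self]
  have hmono : Real.qaryEntropy s.card (∑ i ∈ s, max (q i - p i) 0) ≤
      Real.qaryEntropy s.card η :=
    (Real.qaryEntropy_strictMonoOn hcard).monotoneOn ⟨hδ0, hη.trans hη1⟩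
      ⟨hδ0.trans hη, hη1⟩ hη
  have h1 := sum_negMulLog_sub_le_qaryEntropy s p q hp hq hps hqs _ rfl (by linarith)
  have h2 := sum_negMulLog_sub_le_qaryEntropy s q p hq hp hqs hps _ hsymm (by linarith)
  rw [abs_le]
  constructor <;> linarith

/-- The Poisson cumulative distribution function. -/
noncomputable def poissonCdf (lam : ℝ) (k : ℕ) : ℝ := ∑ i ∈ Finset.range (k + 1), poissonPmf lam i

theorem poissonPmf_pos {lam : ℝ} (hl : 0 < lam) (k : ℕ) : 0 < poissonPmf lam k := by
  unfold poissonPmf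
  positivity

theorem poissonPmf_zero (lam : ℝ) : poissonPmf lam 0 = Real.exp (-lam) := by simp [poissonPmf]

theorem succ_mul_poissonPmf_succ (lam : ℝ) (k : ℕ) :
    ((k : ℝ) + 1) * poissonPmf lam (k + 1) = lam * poissonPmf lam k := by
  unfold poissonPmf
  rw [Nat.factorial_succ]
  push_cast
  field_simp
  ring

theorem hasSum_poissonPmf {lam : ℝ} (hl : 0 < lam) : HasSum (poissonPmf lam) 1 :=
  hasSum_one_poissonMeasure ⟨lam, hl.le⟩

theorem poissonCdf_zero (lam : ℝ) : poissonCdf lam 0 = poissonPmf lam 0 := by simp [poissonCdf]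

theorem poissonCdf_succ (lam : ℝ) (k : ℕ) :
    poissonCdf lam (k + 1) = poissonCdf lam k + poissonPmf lam (k + 1) :=
  Finset.sum_range_succ _ _

theorem poissonPmf_le_poissonCdf {lam : ℝ} (hl : 0 < lam) (k : ℕ) :
    poissonPmf lam k ≤ poissonCdf lam k :=
  Finset.single_le_sum (f := poissonPmf lam) (fun i _ => (poissonPmf_pos hl i).le)
    (Finset.self_mem_range_succ k)

theorem poissonCdf_pos {lam : ℝ} (hl : 0 < lam) (k : ℕ) : 0 < poissonCdf lam k :=
  (poissonPmf_pos hl k).trans_le (poissonPmf_le_poissonCdf hl k)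

theorem hasSum_poissonPmf_tail {lam : ℝ} (hl : 0 < lam) (k : ℕ) :
    HasSum (fun j => poissonPmf lam (j + (k + 1))) (1 - poissonCdf lam k) :=
  (hasSum_nat_add_iff' (k + 1)).2 (hasSum_poissonPmf hl)

theorem hasSum_poissonPmf_tail' {lam : ℝ} (hl : 0 < lam) (k : ℕ) :
    HasSum (fun j => poissonPmf lam (j + k)) (1 - poissonCdf lam k + poissonPmf lam k) := by
  have e : 1 - poissonCdf lam k + poissonPmf lam k =
      1 - ∑ i ∈ Finset.range k, poissonPmf lam i := by
    rw [poissonCdf, Finset.sum_range_succ]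
    ring
  rw [e]
  exact (hasSum_nat_add_iff' k).2 (hasSum_poissonPmf hl)

theorem poissonCdf_lt_one {lam : ℝ} (hl : 0 < lam) (k : ℕ) : poissonCdf lam k < 1 := by
  have h := (hasSum_poissonPmf_tail hl k)
  have := h.tsum_eq ▸ h.summable.tsum_pos (fun i => (poissonPmf_pos hl _).le) 0
    (poissonPmf_pos hl _)
  linarith

theorem hasSum_mul_poissonPmf_tail {lam : ℝ} (hl : 0 < lam) (k : ℕ) :
    HasSum (fun j : ℕ => ((j : ℝ) + k + 1) * poissonPmf lam (j + (k + 1)))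
      (lam * (1 - poissonCdf lam k + poissonPmf lam k)) := by
  have e : (fun j : ℕ => ((j : ℝ) + k + 1) * poissonPmf lam (j + (k + 1))) =
      fun j => lam * poissonPmf lam (j + k) := by
    funext j
    rw [← succ_mul_poissonPmf_succ]
    push_cast
    rfl
  rw [e]
  exact (hasSum_poissonPmf_tail' hl k).mul_left lam

theorem succ_mul_poisson_tail_le {lam : ℝ} (hl : 0 < lam) (k : ℕ) :
    ((k : ℝ) + 1) * (1 - poissonCdf lam k) ≤ lam * (1 - poissonCdf lam k + poissonPmf lam k) := by
  refine hasSum_le (fun j => ?_) ((hasSum_poissonPmf_tail hl k).mul_left _)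
    (hasSum_mul_poissonPmf_tail hl k)
  have : (0 : ℝ) ≤ j := j.cast_nonneg
  exact mul_le_mul_of_nonneg_right (by linarith) (poissonPmf_pos hl _).le

theorem succ_mul_poissonPmf_zero_le {lam : ℝ} (hl : 0 < lam) (k : ℕ) :
    ((k : ℝ) + 1) * poissonPmf lam 0 ≤
      ((k : ℝ) + 1 - lam) * poissonCdf lam k + lam * poissonPmf lam k := by
  induction k with
  | zero => rw [poissonCdf_zero]; push_cast; linarith
  | succ k ih =>
    have h := succ_mul_poissonPmf_succ lam k
    have h0 : poissonPmf lam 0 ≤ poissonCdf lam k :=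
      Finset.single_le_sum (f := poissonPmf lam) (fun i _ => (poissonPmf_pos hl i).le)
        (by simp)
    have hp := poissonPmf_pos hl (k + 1)
    rw [poissonCdf_succ]
    push_cast
    linarith

theorem poissonCdf_mul_le {lam : ℝ} (hl : 0 < lam) (k : ℕ) :
    0 ≤ ((k : ℝ) - lam) * poissonCdf lam k + lam * poissonPmf lam k := by
  induction k with
  | zero => rw [poissonCdf_zero]; push_cast; linarith
  | succ k ih =>
    have h := succ_mul_poissonPmf_succ lam k
    have hp := poissonCdf_pos hl k
    rw [poissonCdf_succ]
    push_cast
    linarith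

/-- `P(Z ≤ k) P(Z > k) ≤ λ P(Z = k)` for a Poisson variable `Z`. -/
theorem poissonCdf_mul_tail_le {lam : ℝ} (hl : 0 < lam) (k : ℕ) :
    poissonCdf lam k * (1 - poissonCdf lam k) ≤ lam * poissonPmf lam k := by
  have h1 := mul_le_mul_of_nonneg_left (poissonCdf_mul_le hl k)
    (sub_nonneg.2 (poissonCdf_lt_one hl k).le)
  have h2 := mul_le_mul_of_nonneg_left (succ_mul_poisson_tail_le hl k) (poissonCdf_pos hl k).le
  linarith

/-- `P(Z ≤ k) P(Z > k) ≤ 1.4 √λ P(Z = k)` for a Poisson variable `Z` of mean `λ ≥ 1`. The proof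
compares the maximiser of the quotient of the two sides with its neighbours. -/
theorem poissonCdf_mul_tail_le_sqrt {lam : ℝ} (hl : 1 ≤ lam) (k : ℕ) :
    poissonCdf lam k * (1 - poissonCdf lam k) ≤ 1.4 * √lam * poissonPmf lam k := by
  have hl0 : 0 < lam := by linarith
  set R : ℕ → ℝ := fun k => poissonCdf lam k * (1 - poissonCdf lam k) / poissonPmf lam k with hR
  have hs1 : 1 ≤ √lam := Real.one_le_sqrt.2 hl
  have hss : √lam * √lam = lam := Real.mul_self_sqrt hl0.le
  by_contra! hk
  have hRk : 1.4 * √lam < R k := by rwa [hR, lt_div_iff₀ (poissonPmf_pos hl0 k)]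
  have hbig : ∀ j : ℕ, lam + √lam ≤ j → R j ≤ 1.4 * √lam := by
    intro j hj
    have hp := poissonPmf_pos hl0 j
    have hU := poissonCdf_pos hl0 j
    have hU1 := poissonCdf_lt_one hl0 j
    rw [hR, div_le_iff₀ hp]
    have h := succ_mul_poisson_tail_le hl0 j
    have h1 : √lam * (1 - poissonCdf lam j) ≤ lam * poissonPmf lam j := by nlinarith
    have h2 : 1 - poissonCdf lam j ≤ √lam * poissonPmf lam j := by
      refine le_of_mul_le_mul_left (h1.trans_eq ?_) (by linarith : 0 < √lam)
      rw [← mul_assoc, hss]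
    have h3 : 0 ≤ √lam * poissonPmf lam j := by positivity
    nlinarith
  obtain ⟨N, hN⟩ := exists_nat_ge (lam + √lam)
  have hlt : ∀ j : ℕ, N ≤ j → R j ≤ 1.4 * √lam := fun j hj =>
    hbig j (hN.trans (by exact_mod_cast hj))
  have hkN : k < N := by
    by_contra! h
    exact absurd (hlt k h) (not_le.2 hRk)
  obtain ⟨m, -, hmax⟩ := Finset.exists_max_image (Finset.range N) R ⟨k, Finset.mem_range.2 hkN⟩
  have hmk : R k ≤ R m := hmax k (Finset.mem_range.2 hkN)
  have hall : ∀ j, R j ≤ R m := by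
    intro j
    rcases lt_or_ge j N with h | h
    · exact hmax j (Finset.mem_range.2 h)
    · linarith [hlt j h]
  have hRm : 1.4 * √lam < R m := hRk.trans_le hmk
  set U := poissonCdf lam m with hUdef
  set P := poissonPmf lam m with hPdef
  set q := poissonPmf lam (m + 1) with hqdef
  have hP : 0 < P := poissonPmf_pos hl0 m
  have hq : 0 < q := poissonPmf_pos hl0 (m + 1)
  have hU : 0 < U := poissonCdf_pos hl0 m
  have hU1 : U < 1 := poissonCdf_lt_one hl0 m
  have hrec : ((m : ℝ) + 1) * q = lam * P := succ_mul_poissonPmf_succ lam m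
  have hx : (0 : ℝ) < (m : ℝ) + 1 := by positivity
  have hnext : ((m : ℝ) + 1) * ((U + q) * (1 - (U + q))) ≤ lam * (U * (1 - U)) := by
    have h := hall (m + 1)
    simp only [hR] at h
    rw [poissonCdf_succ, div_le_div_iff₀ hq hP] at h
    have h' := mul_le_mul_of_nonneg_left h hx.le
    rw [show ((m : ℝ) + 1) * (U * (1 - U) * q) = (U * (1 - U)) * (((m : ℝ) + 1) * q) by ring,
      hrec] at h'
    refine le_of_mul_le_mul_right ?_ hP
    linarith
  have hprev : lam * ((U - P) * (1 - (U - P))) ≤ m * (U * (1 - U)) := by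
    rcases Nat.eq_zero_or_pos m with hm | hm
    · have : U = P := by rw [hUdef, hPdef, hm, poissonCdf_zero]
      rw [this, hm]
      simp
    · obtain ⟨j, rfl⟩ : ∃ j, m = j + 1 := ⟨m - 1, by omega⟩
      have h := hall j
      have hj := poissonPmf_pos hl0 j
      have hrecj := succ_mul_poissonPmf_succ lam j
      have hUj : poissonCdf lam j = U - P := by rw [hUdef, hPdef, poissonCdf_succ]; ring
      simp only [hR] at h
      rw [div_le_div_iff₀ hj hP, hUj] at h
      have h' := mul_le_mul_of_nonneg_left h hl0.le
      rw [show lam * (U * (1 - U) * poissonPmf lam j) =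
        (U * (1 - U)) * (lam * poissonPmf lam j) by ring, ← hrecj] at h'
      refine le_of_mul_le_mul_right ?_ hP
      push_cast
      linarith
  have hmain : ((m : ℝ) + 1) * (U * (1 - U)) ≤ lam * P ^ 2 * (lam + ((m : ℝ) + 1)) := by
    have h1 : U * (1 - U) ≤ lam * P ^ 2 + (((m : ℝ) + 1) * q) * q +
        (((m : ℝ) + 1) * q - lam * P) * (1 - 2 * U) * (-1) := by nlinarith
    rw [hrec] at h1
    have h2 := mul_le_mul_of_nonneg_left h1 hx.le
    have h3 : ((m : ℝ) + 1) * (lam * P * q) = lam * P * (lam * P) := by rw [← hrec]; ring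
    linarith
  have hgt : 1.4 * √lam * P < U * (1 - U) := by
    have := hRm
    simp only [hR] at this
    rwa [lt_div_iff₀ hP] at this
  have hsq : 1.96 * lam * P ^ 2 < (U * (1 - U)) ^ 2 := by
    have h0 : 0 ≤ 1.4 * √lam * P := by positivity
    have := mul_self_lt_mul_self h0 hgt
    have e : 1.4 * √lam * P * (1.4 * √lam * P) = 1.96 * (√lam * √lam) * P ^ 2 := by ring
    rw [e, hss] at this
    linarith
  have hquarter : (U * (1 - U)) ^ 2 ≤ U * (1 - U) / 4 := by
    have hUT : 0 ≤ U * (1 - U) := mul_nonneg hU.le (by linarith)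
    nlinarith [sq_nonneg (U - 1 / 2)]
  have hsmall : 6.84 * ((m : ℝ) + 1) ≤ lam := by
    have hlP : 0 < lam * P ^ 2 := by positivity
    refine le_of_mul_le_mul_left ?_ hlP
    have := mul_le_mul_of_nonneg_left (hsq.le.trans hquarter) hx.le
    linarith
  have hlow := succ_mul_poissonPmf_zero_le hl0 m
  have h0 : 0 < ((m : ℝ) + 1) * poissonPmf lam 0 := mul_pos hx (poissonPmf_pos hl0 0)
  have h4 : U * (lam - ((m : ℝ) + 1)) ≤ lam * P := by linarith
  have h5 : U * (5.84 / 6.84 * lam) ≤ lam * P :=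
    (mul_le_mul_of_nonneg_left (by linarith) hU.le).trans h4
  have h6 : U * (5.84 / 6.84) ≤ P := by
    refine le_of_mul_le_mul_left ?_ hl0
    linarith
  have h7 : P ≤ √lam * P := le_mul_of_one_le_left hP.le hs1
  nlinarith

/-- Bounded solutions of the Stein equation for the Poisson distribution. -/
theorem exists_poisson_stein_solution {lam : ℝ} (hl : 0 < lam) (f : ℕ → ℝ)
    (hf0 : ∀ k, 0 ≤ f k) (hf1 : ∀ k, f k ≤ 1) (S : ℝ)
    (hS : HasSum (fun k => poissonPmf lam k * f k) S) :
    ∃ g : ℕ → ℝ, (∀ k : ℕ, lam * g (k + 1) - k * g k = f k - S) ∧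
      (∀ k, |g k| ≤ min 1 (1.4 / √lam)) ∧
      (∀ k, |g (k + 2) - g (k + 1)| ≤ (1 - Real.exp (-lam)) / lam) := by
  set L : ℕ → ℝ := fun k => ∑ i ∈ Finset.range (k + 1), poissonPmf lam i * f i with hL
  have hp := poissonPmf_pos hl
  have hL0 : ∀ k, 0 ≤ L k := fun k =>
    Finset.sum_nonneg fun i _ => mul_nonneg (hp i).le (hf0 i)
  have hLU : ∀ k, L k ≤ poissonCdf lam k := fun k =>
    Finset.sum_le_sum fun i _ => mul_le_of_le_one_right (hp i).le (hf1 i)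
  have hLsucc : ∀ k, L (k + 1) = L k + poissonPmf lam (k + 1) * f (k + 1) := fun k =>
    Finset.sum_range_succ _ _
  have htail : ∀ k, HasSum (fun j => poissonPmf lam (j + (k + 1)) * f (j + (k + 1))) (S - L k) :=
    fun k => (hasSum_nat_add_iff' (f := fun k => poissonPmf lam k * f k) (k + 1)).2 hS
  have hR0 : ∀ k, 0 ≤ S - L k := fun k =>
    (htail k).nonneg fun j => mul_nonneg (hp _).le (hf0 _)
  have hRT : ∀ k, S - L k ≤ 1 - poissonCdf lam k := fun k =>
    hasSum_le (fun j => mul_le_of_le_one_right (hp _).le (hf1 _)) (htail k)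
      (hasSum_poissonPmf_tail hl k)
  set g : ℕ → ℝ := fun k => match k with
    | 0 => 0
    | k + 1 => (L k - S * poissonCdf lam k) / (lam * poissonPmf lam k) with hg
  have hgs : ∀ k, g (k + 1) = (L k - S * poissonCdf lam k) / (lam * poissonPmf lam k) :=
    fun k => rfl
  refine ⟨g, ?_, ?_, ?_⟩
  · intro k
    cases k with
    | zero =>
      have hne := (hp 0).ne'
      have : L 0 = poissonPmf lam 0 * f 0 := by simp [hL]
      rw [hgs, this, poissonCdf_zero]
      simp only [CharP.cast_eq_zero, zero_mul, sub_zero]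
      field_simp
    | succ k =>
      have hne := (hp (k + 1)).ne'
      rw [hgs, hgs, ← succ_mul_poissonPmf_succ lam k, hLsucc, poissonCdf_succ]
      have : (k : ℝ) + 1 ≠ 0 := by positivity
      push_cast
      field_simp
      ring
  · intro k
    cases k with
    | zero =>
      have : g 0 = 0 := rfl
      rw [this, abs_zero]
      exact le_min zero_le_one (by positivity)
    | succ k =>
      have hU := poissonCdf_pos hl k
      have hU1 := poissonCdf_lt_one hl k
      have habs : |L k - S * poissonCdf lam k| ≤ poissonCdf lam k * (1 - poissonCdf lam k) := by
        have e : L k - S * poissonCdf lam k =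
            L k * (1 - poissonCdf lam k) - (S - L k) * poissonCdf lam k := by ring
        have h1 := mul_le_mul_of_nonneg_right (hLU k) (sub_nonneg.2 hU1.le)
        have h2 := mul_le_mul_of_nonneg_right (hRT k) hU.le
        have h3 := mul_nonneg (hL0 k) (sub_nonneg.2 hU1.le)
        have h4 := mul_nonneg (hR0 k) hU.le
        rw [e, abs_le]
        constructor <;> linarith
      have hpos : 0 < lam * poissonPmf lam k := mul_pos hl (hp k)
      have hone : |g (k + 1)| ≤ 1 := by
        rw [hgs, abs_div, abs_of_pos hpos, div_le_one hpos]
        exact habs.trans (poissonCdf_mul_tail_le hl k)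
      refine le_min hone ?_
      have hsq : 0 < √lam := Real.sqrt_pos.2 hl
      rcases le_total 1 lam with h1 | h1
      · rw [hgs, abs_div, abs_of_pos hpos, div_le_div_iff₀ hpos hsq]
        have := mul_le_mul_of_nonneg_right (habs.trans (poissonCdf_mul_tail_le_sqrt h1 k)) hsq.le
        have hss : √lam * √lam = lam := Real.mul_self_sqrt hl.le
        calc _ ≤ _ := this
          _ = 1.4 * (√lam * √lam * poissonPmf lam k) := by ring
          _ = _ := by rw [hss]
      · refine hone.trans ?_
        rw [le_div_iff₀ hsq]
        have : √lam ≤ 1 := Real.sqrt_le_one.2 h1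
        linarith
  · intro k
    set U := poissonCdf lam k with hUdef
    set q := poissonPmf lam (k + 1) with hqdef
    have hq : 0 < q := hp (k + 1)
    have hx : (0 : ℝ) < (k : ℝ) + 1 := by positivity
    have hrec : ((k : ℝ) + 1) * q = lam * poissonPmf lam k := succ_mul_poissonPmf_succ lam k
    have hA : (1 - (U + q)) / lam - (1 - U) / ((k : ℝ) + 1) ≤ 0 := by
      have h := succ_mul_poisson_tail_le hl (k + 1)
      have hlt := poissonCdf_lt_one hl (k + 1)
      rw [poissonCdf_succ] at h hlt
      push_cast at h
      rw [sub_nonpos, div_le_div_iff₀ hl hx]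
      change ((k : ℝ) + 1 + 1) * (1 - (U + q)) ≤ lam * (1 - (U + q) + q) at h
      linarith
    have hB' : lam * U ≤ ((k : ℝ) + 1) * (U + q - poissonPmf lam 0) := by
      have h := succ_mul_poissonPmf_zero_le hl k
      rw [← hrec] at h
      linarith
    have hB'' : U / ((k : ℝ) + 1) ≤ (U + q - poissonPmf lam 0) / lam := by
      rw [div_le_div_iff₀ hx hl]
      linarith
    have hB : U / ((k : ℝ) + 1) - (U + q) / lam ≤ 0 := by
      have : 0 ≤ poissonPmf lam 0 / lam := (div_pos (hp 0) hl).le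
      rw [sub_div] at hB''
      linarith
    have hC : (1 - (U + q)) / lam + U / ((k : ℝ) + 1) ≤ (1 - Real.exp (-lam)) / lam := by
      rw [← poissonPmf_zero]
      calc _ ≤ (1 - (U + q)) / lam + (U + q - poissonPmf lam 0) / lam := by linarith
        _ = _ := by ring
    have hC0 : 0 ≤ (1 - (U + q)) / lam + U / ((k : ℝ) + 1) := by
      have hlt := poissonCdf_lt_one hl (k + 1)
      rw [poissonCdf_succ] at hlt
      have hU := poissonCdf_pos hl k
      exact add_nonneg (div_nonneg (by linarith) hl.le) (div_nonneg hU.le hx.le)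
    have hΔ : q * (g (k + 2) - g (k + 1)) =
        L k * ((1 - (U + q)) / lam - (1 - U) / ((k : ℝ) + 1)) +
          (S - L (k + 1)) * (U / ((k : ℝ) + 1) - (U + q) / lam) +
          q * f (k + 1) * ((1 - (U + q)) / lam + U / ((k : ℝ) + 1)) := by
      rw [hgs, hgs, ← hrec, hLsucc, poissonCdf_succ, ← hUdef, ← hqdef]
      field_simp
      ring
    have hzero : U * ((1 - (U + q)) / lam - (1 - U) / ((k : ℝ) + 1)) +
          (1 - (U + q)) * (U / ((k : ℝ) + 1) - (U + q) / lam) +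
          q * ((1 - (U + q)) / lam + U / ((k : ℝ) + 1)) = 0 := by
      field_simp
      ring
    have hRT' : S - L (k + 1) ≤ 1 - (U + q) := by
      have := hRT (k + 1)
      rwa [poissonCdf_succ] at this
    have t1 := mul_le_mul_of_nonpos_right (hLU k) hA
    have t2 := mul_nonpos_of_nonneg_of_nonpos (hL0 k) hA
    have t3 := mul_le_mul_of_nonpos_right hRT' hB
    have t4 := mul_nonpos_of_nonneg_of_nonpos (hR0 (k + 1)) hB
    have t5 := mul_nonneg (mul_nonneg hq.le (hf0 (k + 1))) hC0
    have t6 := mul_le_mul_of_nonneg_right (mul_le_of_le_one_right hq.le (hf1 (k + 1))) hC0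
    refine le_trans ?_ hC
    rw [abs_le]
    constructor
    · refine le_of_mul_le_mul_left ?_ hq
      linarith
    · refine le_of_mul_le_mul_left ?_ hq
      linarith

theorem abs_sub_le_mul_of_succ_le {g : ℕ → ℝ} {c : ℝ}
    (hg : ∀ k, |g (k + 2) - g (k + 1)| ≤ c) (a d : ℕ) :
    |g (a + d + 1) - g (a + 1)| ≤ c * d := by
  induction d with
  | zero => simp
  | succ d ih =>
    have h := hg (a + d)
    have e : g (a + (d + 1) + 1) - g (a + 1) =
        (g (a + d + 2) - g (a + d + 1)) + (g (a + d + 1) - g (a + 1)) := by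
      rw [show a + (d + 1) + 1 = a + d + 2 by ring]
      ring
    rw [e]
    push_cast
    linarith [abs_add_le (g (a + d + 2) - g (a + d + 1)) (g (a + d + 1) - g (a + 1))]

theorem integral_natCast_of_le_one {Ω : Type*} [MeasurableSpace Ω] (μ : Measure Ω)
    {X : Ω → ℕ} (hX : Measurable X) (hX1 : ∀ ω, X ω ≤ 1) :
    ∫ ω, (X ω : ℝ) ∂μ = (μ {ω | X ω = 1}).toReal := by
  have hs : MeasurableSet {ω | X ω = 1} := hX (measurableSet_singleton 1)
  have e : (fun ω => (X ω : ℝ)) = Set.indicator {ω | X ω = 1} 1 := by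
    funext ω
    by_cases h : X ω = 1
    · simp [h]
    · have : X ω = 0 := by have := hX1 ω; omega
      simp [this]
  rw [e, integral_indicator_one hs]
  rfl

/-- Integrating a centred variable against a bounded function of the conditioning information. -/
theorem integral_mul_le_of_condExp {Ω : Type*} {m mΩ : MeasurableSpace Ω} (μ : Measure Ω)
    [IsProbabilityMeasure μ] (hm : m ≤ mΩ) {h G : Ω → ℝ}
    (hh : Integrable h μ) (hG : Measurable[m] G) {c : ℝ} (hc : ∀ ω, |G ω| ≤ c) :
    -∫ ω, h ω * G ω ∂μ ≤ c * ∫ ω, |(μ[h | m]) ω| ∂μ := by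
  have hGs : StronglyMeasurable[m] G := hG.stronglyMeasurable
  have hGm : AEStronglyMeasurable G μ := (hG.mono hm le_rfl).aestronglyMeasurable
  have hint : Integrable (h * G) μ := by
    have := hh.mul_bdd (c := c) hGm (Filter.Eventually.of_forall hc)
    exact this
  have hpull := condExp_mul_of_stronglyMeasurable_right hGs hint hh
  have h1 : ∫ ω, h ω * G ω ∂μ = ∫ ω, (μ[h | m]) ω * G ω ∂μ := by
    have := integral_condExp hm (μ := μ) (f := h * G)
    rw [integral_congr_ae hpull] at this
    exact this.symm
  rw [h1, ← integral_neg, ← integral_const_mul]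
  have hci : Integrable (μ[h | m]) μ := integrable_condExp
  refine integral_mono (hci.mul_bdd (c := c) hGm (Filter.Eventually.of_forall hc)).neg
    (hci.abs.const_mul c) fun ω => ?_
  have h2 : -((μ[h | m]) ω * G ω) ≤ |(μ[h | m]) ω * G ω| := neg_le_abs _
  rw [abs_mul] at h2
  have h3 := mul_le_mul_of_nonneg_left (hc ω) (abs_nonneg ((μ[h | m]) ω))
  change -((μ[h | m]) ω * G ω) ≤ c * |(μ[h | m]) ω|
  linarith

theorem measurable_sum_iSup_comap {Ω I : Type*} (X : I → Ω → ℕ) (T : Finset I) :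
    Measurable[⨆ β ∈ T, MeasurableSpace.comap (X β) inferInstance] fun ω => ∑ β ∈ T, X β ω :=
  Finset.measurable_fun_sum _ fun β hβ => (comap_measurable (X β)).mono
    (le_iSup₂ (f := fun β (_ : β ∈ T) => MeasurableSpace.comap (X β) inferInstance) β hβ) le_rfl

section ChenStein

variable {Ω : Type*} [mΩ : MeasurableSpace Ω] (μ : Measure Ω) [IsProbabilityMeasure μ]

theorem integrable_of_measurable_of_abs_le {f : Ω → ℝ} (hf : Measurable f) (C : ℝ)
    (hC : ∀ ω, |f ω| ≤ C) : Integrable f μ :=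
  Integrable.of_bound hf.aestronglyMeasurable C (Filter.Eventually.of_forall hC)

theorem integral_ite_mem_eq_sum {W : Ω → ℕ} (hW : Measurable W) (A : Finset ℕ) :
    ∫ ω, (if W ω ∈ A then (1 : ℝ) else 0) ∂μ = ∑ k ∈ A, (μ {ω | W ω = k}).toReal := by
  have hs : ∀ k, MeasurableSet {ω | W ω = k} := fun k => hW (measurableSet_singleton k)
  have e : (fun ω => if W ω ∈ A then (1 : ℝ) else 0) =
      fun ω => ∑ k ∈ A, Set.indicator {ω | W ω = k} (1 : Ω → ℝ) ω := by
    funext ω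
    simp [Set.indicator_apply]
  rw [e, integral_finsetSum]
  · refine Finset.sum_congr rfl fun k _ => ?_
    rw [integral_indicator_one (hs k)]
    rfl
  · intro k _
    exact (integrable_const (1 : ℝ)).indicator (hs k)

variable {I : Type*} [Fintype I] [DecidableEq I]

/-- The contribution of a single index to the Chen-Stein bound. -/
theorem integral_stein_index_le (X : I → Ω → ℕ) (hXmeas : ∀ α, Measurable (X α))
    (hXbin : ∀ α ω, X α ω ≤ 1) (p : I → ℝ) (hp : ∀ α, p α = (μ {ω | X α ω = 1}).toReal)
    (B : Finset I) (α : I) (hB : α ∈ B) (g : ℕ → ℝ) (c₁ c₂ : ℝ)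
    (hg₁ : ∀ k, |g k| ≤ c₁) (hg₂ : ∀ k, |g (k + 2) - g (k + 1)| ≤ c₂) :
    ∫ ω, (p α * g (∑ β, X β ω + 1) - X α ω * g (∑ β, X β ω)) ∂μ ≤
      c₂ * (∑ β ∈ B, p α * p β + ∑ β ∈ B.erase α, ∫ ω, ((X α ω : ℝ) * (X β ω : ℝ)) ∂μ) +
      c₁ * ∫ ω, |(μ[(fun ω' => (X α ω' : ℝ) - p α) |
            ⨆ β ∈ ((Finset.univ : Finset I) \ B),
              MeasurableSpace.comap (X β) inferInstance]) ω| ∂μ := by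
  have hm : ⨆ β ∈ ((Finset.univ : Finset I) \ B),
      MeasurableSpace.comap (X β) inferInstance ≤ mΩ := iSup₂_le fun β _ => (hXmeas β).comap_le
  have hp0 : 0 ≤ p α := hp α ▸ ENNReal.toReal_nonneg
  set V : Ω → ℕ := fun ω => ∑ β ∈ Finset.univ \ B, X β ω with hV
  set Y : Ω → ℕ := fun ω => ∑ β ∈ B.erase α, X β ω with hY
  have hW : ∀ ω, ∑ β, X β ω = V ω + Y ω + X α ω := by
    intro ω
    rw [← Finset.sum_sdiff (Finset.subset_univ B), ← Finset.sum_erase_add B _ hB, add_assoc]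
  have hVm := measurable_sum_iSup_comap X (Finset.univ \ B)
  have hgm : Measurable g := measurable_from_nat
  have hg_succ : Measurable fun k : ℕ => g (k + 1) := measurable_from_nat
  have hGm := hg_succ.comp hVm
  have hXi : ∀ β, Integrable (fun ω => (X β ω : ℝ)) μ := fun β =>
    integrable_of_measurable_of_abs_le μ (measurable_from_nat.comp (hXmeas β)) 1 fun ω => by
      rw [abs_of_nonneg (Nat.cast_nonneg _)]
      exact_mod_cast hXbin β ω
  have hXXi : ∀ β, Integrable (fun ω => (X α ω : ℝ) * X β ω) μ := fun β => by
    refine (hXi α).mul_bdd (c := 1) (hXi β).aestronglyMeasurable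
      (Filter.Eventually.of_forall fun ω => ?_)
    rw [Real.norm_of_nonneg (Nat.cast_nonneg _)]
    exact_mod_cast hXbin β ω
  have hEX : ∀ β, ∫ ω, (X β ω : ℝ) ∂μ = p β := fun β => by
    rw [integral_natCast_of_le_one μ (hXmeas β) (hXbin β), hp]
  have hh : Integrable (fun ω => (X α ω : ℝ) - p α) μ := (hXi α).sub (integrable_const _)
  have hhG : Integrable (fun ω => ((X α ω : ℝ) - p α) * g (V ω + 1)) μ :=
    hh.mul_bdd (c := c₁) (hGm.mono hm le_rfl).aestronglyMeasurable
      (Filter.Eventually.of_forall fun ω => hg₁ _)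
  have hcond := integral_mul_le_of_condExp μ hm (G := fun ω => g (V ω + 1)) hh hGm (c := c₁)
    fun ω => hg₁ _
  have hpt : ∀ ω, p α * g (∑ β, X β ω + 1) - X α ω * g (∑ β, X β ω) ≤
      c₂ * (p α * X α ω + ∑ β ∈ B.erase α, (p α * X β ω + (X α ω : ℝ) * X β ω)) -
        ((X α ω : ℝ) - p α) * g (V ω + 1) := by
    intro ω
    have hYc : (Y ω : ℝ) = ∑ β ∈ B.erase α, (X β ω : ℝ) := by simp [hY]
    rw [Finset.sum_add_distrib, ← Finset.mul_sum, ← Finset.mul_sum, ← hYc, hW ω]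
    have e1 := abs_sub_le_mul_of_succ_le hg₂ (V ω) (Y ω)
    have hY0 : (0 : ℝ) ≤ Y ω := Nat.cast_nonneg _
    have hx : X α ω = 0 ∨ X α ω = 1 := by have := hXbin α ω; omega
    rw [abs_le] at e1
    have e1' := mul_le_mul_of_nonneg_left e1.2 hp0
    rcases hx with hx | hx
    · rw [hx]
      simp only [Nat.cast_zero, add_zero]
      linarith
    · have e2 := abs_sub_le_mul_of_succ_le hg₂ (V ω + Y ω) 1
      rw [abs_le] at e2
      have e2' := mul_le_mul_of_nonneg_left e2.2 hp0
      rw [hx]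
      push_cast at e2' ⊢
      linarith
  have hWi : Integrable (fun ω => p α * g (∑ β, X β ω + 1) - X α ω * g (∑ β, X β ω)) μ := by
    have hWm : Measurable fun ω => ∑ β, X β ω := Finset.measurable_fun_sum _ fun β _ => hXmeas β
    refine Integrable.sub ?_ ?_
    · exact (integrable_of_measurable_of_abs_le μ
        (hg_succ.comp hWm) c₁ fun ω => hg₁ _).const_mul _
    · exact (hXi α).mul_bdd (c := c₁) (hgm.comp hWm).aestronglyMeasurable
        (Filter.Eventually.of_forall fun ω => hg₁ _)
  have hsi : ∀ β ∈ B.erase α, Integrable (fun ω => p α * X β ω + (X α ω : ℝ) * X β ω) μ :=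
    fun β _ => ((hXi β).const_mul _).add (hXXi β)
  have hsum_i : Integrable (fun ω => ∑ β ∈ B.erase α, (p α * X β ω + (X α ω : ℝ) * X β ω)) μ :=
    integrable_finsetSum _ hsi
  have hadd_i : Integrable
      (fun ω => p α * X α ω + ∑ β ∈ B.erase α, (p α * X β ω + (X α ω : ℝ) * X β ω)) μ :=
    ((hXi α).const_mul _).add hsum_i
  have hmono := integral_mono hWi ((hadd_i.const_mul c₂).sub hhG) hpt
  refine hmono.trans ?_
  have hcalc : ∫ ω, (c₂ * (p α * X α ω + ∑ β ∈ B.erase α, (p α * X β ω + (X α ω : ℝ) * X β ω)) -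
        ((X α ω : ℝ) - p α) * g (V ω + 1)) ∂μ =
      c₂ * (∑ β ∈ B, p α * p β + ∑ β ∈ B.erase α, ∫ ω, ((X α ω : ℝ) * (X β ω : ℝ)) ∂μ) -
        ∫ ω, ((X α ω : ℝ) - p α) * g (V ω + 1) ∂μ := by
    rw [integral_sub (hadd_i.const_mul c₂) hhG,
      integral_const_mul, integral_add ((hXi α).const_mul (p α)) hsum_i, integral_const_mul, hEX,
      integral_finsetSum _ hsi, ← Finset.sum_erase_add B _ hB]
    have : ∀ β ∈ B.erase α, ∫ ω, (p α * X β ω + (X α ω : ℝ) * X β ω) ∂μ =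
        p α * p β + ∫ ω, (X α ω : ℝ) * X β ω ∂μ := fun β _ => by
      rw [integral_add ((hXi β).const_mul _) (hXXi β), integral_const_mul, hEX]
    rw [Finset.sum_congr rfl this, Finset.sum_add_distrib]
    ring
  change ∫ ω, (c₂ * (p α * X α ω + ∑ β ∈ B.erase α, (p α * X β ω + (X α ω : ℝ) * X β ω)) -
        ((X α ω : ℝ) - p α) * g (V ω + 1)) ∂μ ≤ _
  rw [hcalc]
  linarith

/-- The Chen-Stein bound for Poisson approximation of a sum of dependent Bernoulli variables. -/
theorem chen_stein_le (X : I → Ω → ℕ) (hXmeas : ∀ α, Measurable (X α))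
    (hXbin : ∀ α ω, X α ω ≤ 1) (p : I → ℝ) (hp : ∀ α, p α = (μ {ω | X α ω = 1}).toReal)
    (lam : ℝ) (hlam : lam = ∑ α, p α) (hlampos : 0 < lam)
    (B : I → Finset I) (hB : ∀ α, α ∈ B α) (A : Finset ℕ) :
    ∑ k ∈ A, (μ {ω | ∑ α, X α ω = k}).toReal - ∑ k ∈ A, poissonPmf lam k ≤
      (∑ α, ∑ β ∈ B α, p α * p β +
        ∑ α, ∑ β ∈ (B α).erase α, ∫ ω, ((X α ω : ℝ) * (X β ω : ℝ)) ∂μ) *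
          ((1 - Real.exp (-lam)) / lam) +
      (∑ α, ∫ ω, |(μ[(fun ω' => (X α ω' : ℝ) - p α) |
            ⨆ β ∈ ((Finset.univ : Finset I) \ B α),
              MeasurableSpace.comap (X β) inferInstance]) ω| ∂μ) * min 1 (1.4 / √lam) := by
  have hS : HasSum (fun k => poissonPmf lam k * (if k ∈ A then (1 : ℝ) else 0))
      (∑ k ∈ A, poissonPmf lam k) := by
    have h : ∑ k ∈ A, poissonPmf lam k =
        ∑ k ∈ A, poissonPmf lam k * (if k ∈ A then (1 : ℝ) else 0) :=
      Finset.sum_congr rfl fun k hk => by simp [hk]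
    rw [h]
    exact hasSum_sum_of_ne_finset_zero fun k hk => by simp [hk]
  obtain ⟨g, hstein, hg₁, hg₂⟩ := exists_poisson_stein_solution hlampos
    (fun k => if k ∈ A then (1 : ℝ) else 0) (fun k => by positivity)
    (fun k => by split_ifs <;> norm_num) _ hS
  have hWm : Measurable fun ω => ∑ β, X β ω := Finset.measurable_fun_sum _ fun β _ => hXmeas β
  have hgm : Measurable g := measurable_from_nat
  have hint : ∀ α, Integrable
      (fun ω => p α * g (∑ β, X β ω + 1) - X α ω * g (∑ β, X β ω)) μ := fun α => by
    refine Integrable.sub ?_ ?_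
    · exact (integrable_of_measurable_of_abs_le μ
        ((measurable_from_nat (f := fun k : ℕ => g (k + 1))).comp hWm) _
        fun ω => hg₁ _).const_mul _
    · refine Integrable.mul_bdd (c := min 1 (1.4 / √lam)) ?_
        (hgm.comp hWm).aestronglyMeasurable (Filter.Eventually.of_forall fun ω => hg₁ _)
      refine integrable_of_measurable_of_abs_le μ (measurable_from_nat.comp (hXmeas α)) 1 fun ω => ?_
      rw [abs_of_nonneg (Nat.cast_nonneg _)]
      exact_mod_cast hXbin α ω
  have hfi : Integrable (fun ω => if ∑ β, X β ω ∈ A then (1 : ℝ) else 0) μ :=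
    integrable_of_measurable_of_abs_le μ
      ((measurable_from_nat (f := fun k : ℕ => if k ∈ A then (1 : ℝ) else 0)).comp hWm) 1
      fun ω => by split_ifs <;> norm_num
  have heq : ∑ k ∈ A, (μ {ω | ∑ α, X α ω = k}).toReal - ∑ k ∈ A, poissonPmf lam k =
      ∑ α, ∫ ω, (p α * g (∑ β, X β ω + 1) - X α ω * g (∑ β, X β ω)) ∂μ := by
    rw [← integral_ite_mem_eq_sum μ hWm A, ← integral_finsetSum _ fun α _ => hint α]
    have : ∫ ω, ((if ∑ β, X β ω ∈ A then (1 : ℝ) else 0) - ∑ k ∈ A, poissonPmf lam k) ∂μ =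
        ∫ ω, (if ∑ β, X β ω ∈ A then (1 : ℝ) else 0) ∂μ - ∑ k ∈ A, poissonPmf lam k := by
      rw [integral_sub hfi (integrable_const _)]
      simp
    rw [← this]
    refine integral_congr_ae (Filter.Eventually.of_forall fun ω => ?_)
    dsimp only
    rw [Finset.sum_sub_distrib, ← Finset.sum_mul, ← Finset.sum_mul, ← hlam, ← hstein]
    push_cast
    rfl
  rw [heq]
  refine (Finset.sum_le_sum fun α _ =>
    integral_stein_index_le μ X hXmeas hXbin p hp (B α) α (hB α) g _ _ hg₁ hg₂).trans_eq ?_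
  rw [Finset.sum_add_distrib, ← Finset.mul_sum, ← Finset.mul_sum, Finset.sum_add_distrib]
  ring

end ChenStein

/-- The Poisson distribution with all its mass beyond `m` moved to `m`. -/
noncomputable def poissonTruncated (lam : ℝ) (m k : ℕ) : ℝ :=
  if k < m then poissonPmf lam k else 1 - ∑ i ∈ Finset.range m, poissonPmf lam i

theorem entropyPmf_eq_tsum_negMulLog (P : ℕ → ℝ) :
    entropyPmf P = ∑' k, Real.negMulLog (P k) := by
  simp only [entropyPmf, Real.negMulLog, neg_mul, tsum_neg]

/-- The entropy lost by merging the tail of a Poisson distribution into one atom. -/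
theorem entropyPmf_poissonPmf_sub_truncated {lam : ℝ} (hl : 0 < lam) (s : ℕ) (hs : lam ≤ s) :
    |entropyPmf (poissonPmf lam) -
      ∑ k ∈ Finset.range (s + 2), Real.negMulLog (poissonTruncated lam (s + 1) k)| ≤
      Real.log 2 * (lam * poissonPmf lam s) := by
  have hp := poissonPmf_pos hl
  set T := 1 - poissonCdf lam s with hT
  have hT0 : 0 < T := sub_pos.2 (poissonCdf_lt_one hl s)
  have htail : HasSum (fun j => poissonPmf lam (j + (s + 1))) T := hasSum_poissonPmf_tail hl s
  have hmul : HasSum (fun j : ℕ => ((j : ℝ) + 1) * poissonPmf lam (j + (s + 1)))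
      (lam * (T + poissonPmf lam s) - s * T) := by
    have := (hasSum_mul_poissonPmf_tail hl s).sub (htail.mul_left (s : ℝ))
    have e : (fun j : ℕ => ((j : ℝ) + 1) * poissonPmf lam (j + (s + 1))) = fun j : ℕ =>
        ((j : ℝ) + s + 1) * poissonPmf lam (j + (s + 1)) -
          s * poissonPmf lam (j + (s + 1)) := by
      funext j
      ring
    rw [e]
    exact this
  have hgeo : HasSum (fun j : ℕ => T * (1 / 2 : ℝ) ^ (j + 1)) T := by
    have := (hasSum_geometric_two).mul_left (T / 2)
    have e : (fun j : ℕ => T * (1 / 2 : ℝ) ^ (j + 1)) =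
        fun j : ℕ => T / 2 * (1 / 2 : ℝ) ^ j := by
      funext j
      ring
    rw [e]
    simpa using this
  have hupper : ∀ j : ℕ, Real.negMulLog (poissonPmf lam (j + (s + 1))) ≤
      Real.log 2 * (((j : ℝ) + 1) * poissonPmf lam (j + (s + 1))) -
        Real.log T * poissonPmf lam (j + (s + 1)) +
        (T * (1 / 2 : ℝ) ^ (j + 1) - poissonPmf lam (j + (s + 1))) := by
    intro j
    have hpow : (0 : ℝ) < (1 / 2) ^ (j + 1) := by positivity
    have h := negMulLog_le_of_pos (hp (j + (s + 1))).le (mul_pos hT0 hpow)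
    rw [Real.log_mul hT0.ne' hpow.ne', Real.log_pow, one_div, Real.log_inv] at h
    rw [one_div]
    push_cast at h
    linarith
  have hle1 : ∀ k, poissonPmf lam k ≤ 1 := fun k =>
    le_hasSum (hasSum_poissonPmf hl) k fun i _ => (hp i).le
  have hnn : ∀ j : ℕ, 0 ≤ Real.negMulLog (poissonPmf lam (j + (s + 1))) := fun j =>
    Real.negMulLog_nonneg (hp _).le (hle1 _)
  have hUsum := ((hmul.mul_left (Real.log 2)).sub (htail.mul_left (Real.log T))).add
    (hgeo.sub htail)
  have hsumm : Summable fun j => Real.negMulLog (poissonPmf lam (j + (s + 1))) :=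
    Summable.of_nonneg_of_le hnn hupper hUsum.summable
  have hle := hasSum_le hupper hsumm.hasSum hUsum
  have hge : Real.negMulLog T ≤ ∑' j, Real.negMulLog (poissonPmf lam (j + (s + 1))) := by
    have h1 := htail.mul_left (-Real.log T)
    have : Real.negMulLog T = -Real.log T * T := by simp only [Real.negMulLog]; ring
    rw [this]
    refine hasSum_le (fun j => ?_) h1 hsumm.hasSum
    have hjT : poissonPmf lam (j + (s + 1)) ≤ T :=
      le_hasSum htail j fun i _ => (hp _).le
    have hlog := mul_le_mul_of_nonneg_left (Real.log_le_log (hp (j + (s + 1))) hjT)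
      (hp (j + (s + 1))).le
    simp only [Real.negMulLog]
    linarith
  have hfull : Summable fun k => Real.negMulLog (poissonPmf lam k) :=
    (summable_nat_add_iff (s + 1)).1 hsumm
  have hsplit := hfull.sum_add_tsum_nat_add (s + 1)
  have htr : ∑ k ∈ Finset.range (s + 2), Real.negMulLog (poissonTruncated lam (s + 1) k) =
      ∑ k ∈ Finset.range (s + 1), Real.negMulLog (poissonPmf lam k) + Real.negMulLog T := by
    rw [Finset.sum_range_succ]
    congr 1
    · refine Finset.sum_congr rfl fun k hk => ?_
      rw [poissonTruncated, if_pos (Finset.mem_range.1 hk)]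
    · rw [poissonTruncated, if_neg (lt_irrefl _)]
      rfl
  rw [entropyPmf_eq_tsum_negMulLog, ← hsplit, htr]
  have hlog2 : 0 < Real.log 2 := Real.log_pos one_lt_two
  have hfin : Real.log 2 * (lam * (T + poissonPmf lam s) - s * T) ≤
      Real.log 2 * (lam * poissonPmf lam s) := by
    refine mul_le_mul_of_nonneg_left ?_ hlog2.le
    nlinarith
  have hTlog : Real.negMulLog T = -(Real.log T * T) := by simp only [Real.negMulLog]; ring
  rw [abs_le]
  constructor
  · have : 0 ≤ Real.log 2 * (lam * poissonPmf lam s) :=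
      mul_nonneg hlog2.le (mul_nonneg hl.le (hp s).le)
    linarith
  · linarith

theorem log_two_mul_poissonPmf_le_muBound {lam : ℝ} (hl : 0 < lam) (s : ℕ) (hs : 1 ≤ s) :
    Real.log 2 * (lam * poissonPmf lam s) ≤ muBound lam ((s + 2 : ℕ) : ℝ) := by
  have hs0 : (0 : ℝ) < s := by exact_mod_cast hs
  have hexp : poissonPmf lam s ≤
      Real.exp (-(lam + (s : ℝ) * Real.log ((s : ℝ) / (lam * Real.exp 1)))) := by
    have hpos : 0 < lam * Real.exp 1 := mul_pos hl (Real.exp_pos 1)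
    have e : Real.exp (-(lam + (s : ℝ) * Real.log ((s : ℝ) / (lam * Real.exp 1)))) =
        Real.exp (-lam) * (lam * Real.exp 1 / s) ^ s := by
      rw [neg_add, Real.exp_add]
      congr 1
      rw [← mul_neg, ← Real.log_inv, inv_div, Real.exp_nat_mul,
        Real.exp_log (div_pos hpos hs0)]
    have hst := Real.pow_div_factorial_le_exp (s : ℝ) hs0.le s
    have hfac : (0 : ℝ) < (Nat.factorial s : ℝ) := by positivity
    rw [e, poissonPmf, mul_div_assoc]
    refine mul_le_mul_of_nonneg_left ?_ (Real.exp_pos _).le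
    rw [div_pow, mul_pow, ← Real.exp_nat_mul, mul_one, mul_div_assoc, div_eq_mul_inv]
    refine mul_le_mul_of_nonneg_left ?_ (by positivity)
    rw [le_div_iff₀ (by positivity), mul_comm, ← div_eq_mul_inv]
    exact hst
  have hcoef : Real.log 2 * lam ≤ max (lam * Real.log (Real.exp 1 / lam)) 0 + lam ^ 2 +
      (6 * Real.log (2 * Real.pi) + 1) / 12 := by
    have h1 : 0 ≤ max (lam * Real.log (Real.exp 1 / lam)) 0 := le_max_right _ _
    have h2 : (1 : ℝ) ≤ Real.log (2 * Real.pi) := by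
      rw [Real.le_log_iff_exp_le (by positivity)]
      linarith [Real.exp_one_lt_d9, Real.pi_gt_three]
    have h3 : Real.log 2 ≤ 1 := by linarith [Real.log_two_lt_d9]
    have h4 : Real.log 2 * lam ≤ lam := mul_le_of_le_one_left hl.le h3
    nlinarith [sq_nonneg (lam - 1 / 2)]
  have hcast : ((s + 2 : ℕ) : ℝ) - 2 = s := by push_cast; ring
  rw [muBound, hcast, ← mul_assoc]
  exact mul_le_mul hcoef hexp (poissonPmf_pos hl s).le
    ((mul_nonneg (Real.log_pos one_lt_two).le hl.le).trans hcoef)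

/-- Poisson approximation of the entropy of a sum of (possibly dependent)
Bernoulli random variables, via the Chen-Stein quantities `b1`, `b2`, `b3`. -/
theorem entropy_poisson_approx_dependent
    {Ω : Type*} [MeasurableSpace Ω] (μ : Measure Ω) [IsProbabilityMeasure μ]
    {I : Type*} [Fintype I] [DecidableEq I] (n : ℕ) (hcard : Fintype.card I = n)
    (X : I → Ω → ℕ) (hXmeas : ∀ α, Measurable (X α)) (hXbin : ∀ α ω, X α ω ≤ 1)
    (p : I → ℝ) (hp : ∀ α, p α = (μ {ω | X α ω = 1}).toReal) (hppos : ∀ α, 0 < p α)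
    (lam : ℝ) (hlam : lam = ∑ α, p α) (hlampos : 0 < lam)
    (PW : ℕ → ℝ) (hPW : ∀ k, PW k = (μ {ω | ∑ α, X α ω = k}).toReal)
    (B : I → Finset I) (hB : ∀ α, α ∈ B α)
    (b1 b2 b3 : ℝ)
    (hb1 : b1 = ∑ α, ∑ β ∈ B α, p α * p β)
    (hb2 : b2 = ∑ α, ∑ β ∈ (B α).erase α, ∫ ω, ((X α ω : ℝ) * (X β ω : ℝ)) ∂μ)
    (hb3 : b3 = ∑ α, ∫ ω,
        |(μ[(fun ω' => (X α ω' : ℝ) - p α) |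
            ⨆ β ∈ ((Finset.univ : Finset I) \ B α),
              MeasurableSpace.comap (X β) inferInstance]) ω| ∂μ)
    (η : ℝ)
    (hη : η = (b1 + b2) * ((1 - Real.exp (-lam)) / lam) +
        b3 * min 1 (1.4 / Real.sqrt lam))
    (hη1 : η < 1)
    (M : ℕ) (hM1 : n + 2 ≤ M) (hM2 : 1 / (1 - η) ≤ (M : ℝ)) :
    |entropyPmf (poissonPmf lam) - entropyPmf PW| ≤
      η * Real.log ((M : ℝ) - 1) + binEnt η + muBound lam (M : ℝ) := by
  have hn : 1 ≤ n := by
    rw [← hcard]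
    by_contra! h
    have : IsEmpty I := Fintype.card_eq_zero_iff.1 (by omega)
    rw [hlam, Finset.univ_eq_empty, Finset.sum_empty] at hlampos
    exact lt_irrefl _ hlampos
  obtain ⟨s, rfl⟩ : ∃ s, M = s + 2 := ⟨M - 2, by omega⟩
  have hns : n ≤ s := by omega
  have hlams : lam ≤ s := by
    have h1 : ∀ α ∈ Finset.univ, p α ≤ 1 := fun α _ => by
      rw [hp α]
      exact measureReal_le_one
    have h2 := Finset.sum_le_sum h1
    rw [← hlam] at h2
    simp only [Finset.sum_const, Finset.card_univ, hcard, nsmul_eq_mul, mul_one] at h2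
    exact h2.trans (by exact_mod_cast hns)
  have hWm : Measurable fun ω => ∑ β, X β ω := Finset.measurable_fun_sum _ fun β _ => hXmeas β
  have hWn : ∀ ω, ∑ β, X β ω ≤ n := fun ω => by
    refine (Finset.sum_le_sum fun β _ => hXbin β ω).trans ?_
    simp [hcard]
  have hPW0 : ∀ k, 0 ≤ PW k := fun k => hPW k ▸ ENNReal.toReal_nonneg
  have hPWn : ∀ k, n < k → PW k = 0 := fun k hk => by
    have : {ω | ∑ α, X α ω = k} = ∅ := by
      ext ω
      have := hWn ω
      simp only [Set.mem_ofPred_eq, Set.mem_empty_iff_false, iff_false]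
      omega
    rw [hPW k, this]
    simp
  have hPWsum : ∑ k ∈ Finset.range (s + 2), PW k = 1 := by
    have h := integral_ite_mem_eq_sum μ hWm (Finset.range (s + 2))
    have hmem : ∀ ω, ∑ β, X β ω ∈ Finset.range (s + 2) := fun ω => by
      have := hWn ω
      rw [Finset.mem_range]
      omega
    simp only [hmem, if_true, integral_const, probReal_univ, smul_eq_mul, mul_one] at h
    rw [h]
    exact Finset.sum_congr rfl fun k _ => hPW k
  have hQ0 : ∀ k, 0 ≤ poissonTruncated lam (s + 1) k := fun k => by
    rw [poissonTruncated]
    split_ifs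
    · exact (poissonPmf_pos hlampos k).le
    · exact sub_nonneg.2 (poissonCdf_lt_one hlampos s).le
  have hQlt : ∀ k ∈ Finset.range (s + 1),
      poissonTruncated lam (s + 1) k = poissonPmf lam k := fun k hk =>
    if_pos (Finset.mem_range.1 hk)
  have hQsum : ∑ k ∈ Finset.range (s + 2), poissonTruncated lam (s + 1) k = 1 := by
    rw [Finset.sum_range_succ, Finset.sum_congr rfl hQlt, poissonTruncated, if_neg (lt_irrefl _)]
    ring
  have hdist : ∑ k ∈ Finset.range (s + 2), max (PW k - poissonTruncated lam (s + 1) k) 0 ≤ η := by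
    rw [Finset.sum_range_succ, hPWn (s + 1) (by omega),
      max_eq_right (by linarith [hQ0 (s + 1)]), add_zero]
    have hA : ∑ k ∈ Finset.range (s + 1), max (PW k - poissonTruncated lam (s + 1) k) 0 =
        ∑ k ∈ (Finset.range (s + 1)).filter (fun k => poissonPmf lam k < PW k), PW k -
        ∑ k ∈ (Finset.range (s + 1)).filter (fun k => poissonPmf lam k < PW k),
          poissonPmf lam k := by
      rw [← Finset.sum_sub_distrib, Finset.sum_filter]
      refine Finset.sum_congr rfl fun k hk => ?_
      rw [hQlt k hk]
      split_ifs with h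
      · exact max_eq_left (by linarith)
      · exact max_eq_right (by linarith)
    rw [hA, hη, hb1, hb2, hb3, Finset.sum_congr rfl fun k _ => hPW k]
    exact chen_stein_le μ X hXmeas hXbin p hp lam hlam hlampos B hB _
  have hηM : η ≤ 1 - 1 / ((Finset.range (s + 2)).card : ℝ) := by
    rw [Finset.card_range]
    have h1 : 0 < 1 - η := by linarith
    have hMpos : (0 : ℝ) < ((s + 2 : ℕ) : ℝ) := by positivity
    rw [div_le_iff₀ h1] at hM2
    rw [le_sub_comm, div_le_iff₀ hMpos]
    linarith
  have hcont := abs_sum_negMulLog_sub_le (Finset.range (s + 2)) (poissonTruncated lam (s + 1)) PW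
    (fun k _ => hQ0 k) (fun k _ => hPW0 k) hQsum hPWsum (by simp) η hdist hηM
  have hentPW : entropyPmf PW = ∑ k ∈ Finset.range (s + 2), Real.negMulLog (PW k) := by
    rw [entropyPmf_eq_tsum_negMulLog]
    refine tsum_eq_sum fun k hk => ?_
    rw [Finset.mem_range] at hk
    rw [hPWn k (by omega), Real.negMulLog_zero]
  have hq : Real.qaryEntropy (Finset.range (s + 2)).card η =
      η * Real.log (((s + 2 : ℕ) : ℝ) - 1) + binEnt η := by
    rw [Real.qaryEntropy, Real.binEntropy_eq_negMulLog_add_negMulLog_one_sub, Finset.card_range,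
      binEnt]
    simp only [Real.negMulLog]
    push_cast
    ring
  have htrunc := (entropyPmf_poissonPmf_sub_truncated hlampos s hlams).trans
    (log_two_mul_poissonPmf_le_muBound hlampos s (by omega))
  rw [hq] at hcont
  rw [hentPW]
  have := abs_sub_le (entropyPmf (poissonPmf lam))
    (∑ k ∈ Finset.range (s + 2), Real.negMulLog (poissonTruncated lam (s + 1) k))
    (∑ k ∈ Finset.range (s + 2), Real.negMulLog (PW k))
  linarith
end

section
/- Let P and Q be probability mass functions on a common countable set X. Then d_H(P,Q) ≤ √(1 − exp(−D(P||Q)/2)); equivalently, BC(P,Q) ≥ exp(−D(P||Q)/2). -/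
/-- The Hellinger distance between two probability mass functions. -/
noncomputable def hellingerDist {α : Type*} (P Q : α → ℝ) : ℝ :=
  Real.sqrt ((1 / 2) * ∑' x, (Real.sqrt (P x) - Real.sqrt (Q x)) ^ 2)

/-- The Bhattacharyya parameter between two probability mass functions. -/
noncomputable def bcParam {α : Type*} (P Q : α → ℝ) : ℝ := ∑' x, Real.sqrt (P x * Q x)

open Classical in
/-- The relative entropy `D(P‖Q) ∈ [0,∞]` between two probability mass functions:
it equals `∑ₓ P(x) log(P(x)/Q(x))` when `P` is absolutely continuous w.r.t. `Q` and this
series of nonnegative-corrected terms converges, and `+∞` otherwise.  (Note that for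
probability mass functions `∑ₓ (Q(x) - P(x)) = 0`, and the summand
`P(x) log(P(x)/Q(x)) - P(x) + Q(x)` is pointwise nonnegative.) -/
noncomputable def klDivENN {α : Type*} (P Q : α → ℝ) : ENNReal :=
  if ∀ x, Q x = 0 → P x = 0 then
    ∑' x, ENNReal.ofReal (P x * Real.log (P x / Q x) - P x + Q x)
  else ⊤

open Classical in
/-- `exp(-D/2)` for `D ∈ [0,∞]`, with the convention `exp(-∞/2) = 0`. -/
noncomputable def expNegHalf (d : ENNReal) : ℝ :=
  if d = ⊤ then 0 else Real.exp (-d.toReal / 2)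

theorem summable_sqrt_mul {α : Type*} {P Q : α → ℝ}
    (hPnn : ∀ x, 0 ≤ P x) (hQnn : ∀ x, 0 ≤ Q x) (hP : Summable P) (hQ : Summable Q) :
    Summable fun x => Real.sqrt (P x * Q x) := by
  refine Summable.of_nonneg_of_le (fun x => Real.sqrt_nonneg _) (fun x => ?_) (hP.add hQ)
  have hp := hPnn x
  have hq := hQnn x
  exact Real.sqrt_le_iff.mpr ⟨by positivity, by nlinarith [mul_nonneg hp hq]⟩

theorem klTerm_nonneg {p q : ℝ} (hp : 0 ≤ p) (hq : 0 ≤ q) (hac : q = 0 → p = 0) :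
    0 ≤ p * Real.log (p / q) - p + q := by
  rcases hp.eq_or_lt with rfl | hp
  · simpa using hq
  have hq : 0 < q := hq.lt_of_ne fun h => hp.ne' (hac h.symm)
  have h := mul_le_mul_of_nonneg_left (Real.log_le_sub_one_of_pos (div_pos hq hp)) hp.le
  have e : p * (q / p - 1) = q - p := by field_simp
  have e' : Real.log (q / p) = -Real.log (p / q) := by rw [← Real.log_inv, inv_div]
  rw [e, e'] at h
  linarith

/-- The tangent line inequality for `exp` at `c`, evaluated at `log √(q / p)` and scaled by `p`. -/
theorem exp_mul_le_sqrt_mul {p q : ℝ} (hp : 0 ≤ p) (hq : 0 ≤ q) (hac : q = 0 → p = 0) (c : ℝ) :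
    Real.exp c * (p - 1 / 2 * ((p * Real.log (p / q) - p + q) + p - q) - c * p) ≤
      Real.sqrt (p * q) := by
  rcases hp.eq_or_lt with rfl | hp
  · simp
  have hq : 0 < q := hq.lt_of_ne fun h => hp.ne' (hac h.symm)
  set u : ℝ := -(1 / 2) * Real.log (p / q) with hu
  have hexp : p * Real.exp u = Real.sqrt (p * q) := by
    rw [eq_comm, Real.sqrt_eq_iff_mul_self_eq (by positivity) (by positivity), eq_comm]
    have h : Real.exp u * Real.exp u = q / p := by
      rw [← Real.exp_add, ← Real.exp_log (div_pos hq hp), ← inv_div p q, Real.log_inv, hu]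
      congr 1
      ring
    calc p * Real.exp u * (p * Real.exp u) = p * p * (Real.exp u * Real.exp u) := by ring
      _ = p * q := by rw [h]; field_simp
  have htan : Real.exp c * (u - c + 1) ≤ Real.exp u := by
    calc Real.exp c * (u - c + 1) ≤ Real.exp c * Real.exp (u - c) := by
          gcongr; exact Real.add_one_le_exp _
      _ = Real.exp u := by rw [← Real.exp_add]; congr 1; ring
  rw [← hexp]
  refine le_trans (le_of_eq ?_) (mul_le_mul_of_nonneg_left htan hp.le)
  rw [hu]
  ring

theorem expNegHalf_klDivENN_le_bcParam {α : Type*} {P Q : α → ℝ}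
    (hPnn : ∀ x, 0 ≤ P x) (hQnn : ∀ x, 0 ≤ Q x) (hP : HasSum P 1) (hQ : HasSum Q 1) :
    expNegHalf (klDivENN P Q) ≤ bcParam P Q := by
  unfold expNegHalf
  split_ifs with htop
  · exact tsum_nonneg fun x => Real.sqrt_nonneg _
  have hac : ∀ x, Q x = 0 → P x = 0 := by
    by_contra h
    exact htop (if_neg h)
  have hD : klDivENN P Q =
      ∑' x, ENNReal.ofReal (P x * Real.log (P x / Q x) - P x + Q x) := if_pos hac
  set c : ℝ := -(klDivENN P Q).toReal / 2 with hc
  have hf : HasSum (fun x => P x * Real.log (P x / Q x) - P x + Q x)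
      (klDivENN P Q).toReal := by
    rw [hD] at htop ⊢
    have h := ENNReal.hasSum_toReal htop
    rw [← ENNReal.tsum_toReal_eq (ENNReal.ne_top_of_tsum_ne_top htop)] at h
    simpa only [ENNReal.toReal_ofReal (klTerm_nonneg (hPnn _) (hQnn _) (hac _))] using h
  have hsum := ((hP.sub (((hf.add hP).sub hQ).mul_left (1 / 2))).sub
    (hP.mul_left c)).mul_left (Real.exp c)
  have hle := hasSum_le (fun x => exp_mul_le_sqrt_mul (hPnn x) (hQnn x) (hac x) c) hsum
    (summable_sqrt_mul hPnn hQnn hP.summable hQ.summable).hasSum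
  refine le_trans (le_of_eq ?_) hle
  rw [hc]
  ring

theorem hellingerDist_eq_sqrt_one_sub_bcParam {α : Type*} {P Q : α → ℝ}
    (hPnn : ∀ x, 0 ≤ P x) (hQnn : ∀ x, 0 ≤ Q x) (hP : HasSum P 1) (hQ : HasSum Q 1) :
    hellingerDist P Q = Real.sqrt (1 - bcParam P Q) := by
  have hbc : HasSum (fun x => Real.sqrt (P x * Q x)) (bcParam P Q) :=
    (summable_sqrt_mul hPnn hQnn hP.summable hQ.summable).hasSum
  have hsq : ∀ x, (Real.sqrt (P x) - Real.sqrt (Q x)) ^ 2 =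
      P x + Q x - 2 * Real.sqrt (P x * Q x) := fun x => by
    rw [sub_sq, Real.sq_sqrt (hPnn x), Real.sq_sqrt (hQnn x), Real.sqrt_mul (hPnn x)]
    ring
  unfold hellingerDist
  simp_rw [hsq]
  rw [((hP.add hQ).sub (hbc.mul_left 2)).tsum_eq]
  congr 1
  ring

/-- For probability mass functions `P, Q` on a common countable set,
`d_H(P,Q) ≤ √(1 - exp(-D(P‖Q)/2))`, or equivalently `BC(P,Q) ≥ exp(-D(P‖Q)/2)`. -/
theorem hellinger_upper_bound_of_kl
    {𝓧 : Type*} [Countable 𝓧] (P Q : 𝓧 → ℝ)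
    (hPnn : ∀ x, 0 ≤ P x) (hPsum : ∑' x, P x = 1)
    (hQnn : ∀ x, 0 ≤ Q x) (hQsum : ∑' x, Q x = 1) :
    hellingerDist P Q ≤ Real.sqrt (1 - expNegHalf (klDivENN P Q)) ∧
      expNegHalf (klDivENN P Q) ≤ bcParam P Q := by
  have hasSum_one : ∀ {R : 𝓧 → ℝ}, ∑' x, R x = 1 → HasSum R 1 := fun {R} h => by
    have hR : Summable R := by
      by_contra hn
      simp [tsum_eq_zero_of_not_summable hn] at h
    exact h ▸ hR.hasSum
  have hP := hasSum_one hPsum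
  have hQ := hasSum_one hQsum
  have hle := expNegHalf_klDivENN_le_bcParam hPnn hQnn hP hQ
  refine ⟨?_, hle⟩
  rw [hellingerDist_eq_sqrt_one_sub_bcParam hPnn hQnn hP hQ]
  gcongr
end

section
/- Let P and Q be probability mass functions on a common countable set X. Then the Chernoff information satisfies C(P,Q) ≥ −(1/2)·log( 1 − d_TV(P,Q)² ). -/
/-- The Chernoff information between two probability mass functions:
`C(P,Q) = -min_{θ ∈ [0,1]} log(∑ₓ P(x)^θ Q(x)^{1-θ})`. -/
noncomputable def chernoffInfo {α : Type*} (P Q : α → ℝ) : ℝ :=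
  -(⨅ t : Set.Icc (0 : ℝ) 1, Real.log (∑' x, P x ^ (t : ℝ) * Q x ^ (1 - (t : ℝ))))

theorem Real.summable_rpow_mul_rpow_one_sub {α : Type*} {P Q : α → ℝ}
    (hP : ∀ x, 0 ≤ P x) (hQ : ∀ x, 0 ≤ Q x) (hPs : Summable P) (hQs : Summable Q)
    {t : ℝ} (h0 : 0 ≤ t) (h1 : t ≤ 1) :
    Summable fun x ↦ P x ^ t * Q x ^ (1 - t) := by
  refine Summable.of_nonneg_of_le
    (fun x ↦ mul_nonneg (Real.rpow_nonneg (hP x) _) (Real.rpow_nonneg (hQ x) _))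
    (fun x ↦ Real.geom_mean_le_arith_mean2_weighted h0 (sub_nonneg.2 h1) (hP x) (hQ x) (by ring))
    ((hPs.mul_left t).add (hQs.mul_left (1 - t)))

theorem Real.min_le_rpow_mul_rpow_one_sub {a b t : ℝ} (ha : 0 < a) (hb : 0 < b)
    (h0 : 0 ≤ t) (h1 : t ≤ 1) : min a b ≤ a ^ t * b ^ (1 - t) := by
  have hm : 0 < min a b := lt_min ha hb
  calc
    min a b = min a b ^ t * min a b ^ (1 - t) := by
      rw [← Real.rpow_add hm, add_sub_cancel, Real.rpow_one]
    _ ≤ a ^ t * b ^ (1 - t) := by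
      have := sub_nonneg.2 h1
      gcongr
      · exact min_le_left a b
      · exact min_le_right a b

/-- For functions with disjoint supports and unit mass, the logarithm in the definition of the
Chernoff information takes the default value `0` at every exponent. -/
theorem log_tsum_rpow_mul_rpow_eq_zero {α : Type*} {P Q : α → ℝ}
    (hPsum : ∑' x, P x = 1) (hQsum : ∑' x, Q x = 1) (hdisj : ∀ x, P x = 0 ∨ Q x = 0) (t : ℝ) :
    Real.log (∑' x, P x ^ t * Q x ^ (1 - t)) = 0 := by
  rcases eq_or_ne t 0 with rfl | ht0
  · simp [hQsum]
  rcases eq_or_ne t 1 with rfl | ht1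
  · simp [hPsum]
  have hzero (x) : P x ^ t * Q x ^ (1 - t) = 0 := by
    rcases hdisj x with h | h
    · simp [h, Real.zero_rpow ht0]
    · simp [h, Real.zero_rpow (sub_ne_zero.2 ht1.symm)]
  simp [hzero]

/-- The Bhattacharyya coefficient of two nonnegative summable functions is at most the geometric
mean of the sums of their pointwise minimum and maximum. -/
theorem tsum_sqrt_mul_le_sqrt {α : Type*} {P Q : α → ℝ}
    (hP : ∀ x, 0 ≤ P x) (hQ : ∀ x, 0 ≤ Q x) (hPs : Summable P) (hQs : Summable Q)
    {A B : ℝ} (hA : HasSum (fun x ↦ min (P x) (Q x)) A) (hB : HasSum (fun x ↦ max (P x) (Q x)) B)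
    (hA0 : 0 < A) (hB0 : 0 < B) :
    ∑' x, P x ^ (1 / 2 : ℝ) * Q x ^ (1 - 1 / 2 : ℝ) ≤ √(A * B) := by
  have hs : Summable fun x ↦ P x ^ (1 / 2 : ℝ) * Q x ^ (1 - 1 / 2 : ℝ) :=
    Real.summable_rpow_mul_rpow_one_sub hP hQ hPs hQs (by norm_num) (by norm_num)
  have hpos : 0 < √(A * B) := Real.sqrt_pos.2 (mul_pos hA0 hB0)
  have hle := hasSum_le (fun x ↦ ?_) (hs.hasSum.mul_left (2 * √(A * B)))
    ((hA.mul_left B).add (hB.mul_left A))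
  · have hsq := Real.sq_sqrt (mul_pos hA0 hB0).le
    refine le_of_mul_le_mul_left ?_ hpos
    nlinarith
  · have hterm : P x ^ (1 / 2 : ℝ) * Q x ^ (1 - 1 / 2 : ℝ) =
        √(min (P x) (Q x) * max (P x) (Q x)) := by
      rw [min_mul_max, Real.sqrt_mul (hP x), Real.sqrt_eq_rpow, Real.sqrt_eq_rpow]
      norm_num
    have hm : 0 ≤ min (P x) (Q x) := le_min (hP x) (hQ x)
    have hM : 0 ≤ max (P x) (Q x) := (hP x).trans (le_max_left _ _)
    rw [hterm, mul_assoc, ← Real.sqrt_mul (mul_pos hA0 hB0).le]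
    have heq : A * B * (min (P x) (Q x) * max (P x) (Q x)) =
        (B * min (P x) (Q x)) * (A * max (P x) (Q x)) := by ring
    rw [heq, Real.sqrt_mul (mul_nonneg hB0.le hm)]
    have := two_mul_le_add_sq √(B * min (P x) (Q x)) √(A * max (P x) (Q x))
    rw [Real.sq_sqrt (mul_nonneg hB0.le hm), Real.sq_sqrt (mul_nonneg hA0.le hM)] at this
    linarith

/-- For probability mass functions `P, Q` on a common countable set,
`C(P,Q) ≥ -(1/2) log(1 - d_TV(P,Q)²)`. -/
theorem chernoff_lower_bound_of_tv
    {𝓧 : Type*} [Countable 𝓧] (P Q : 𝓧 → ℝ)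
    (hPnn : ∀ x, 0 ≤ P x) (hPsum : ∑' x, P x = 1)
    (hQnn : ∀ x, 0 ≤ Q x) (hQsum : ∑' x, Q x = 1) :
    chernoffInfo P Q ≥ -(1 / 2) * Real.log (1 - tvDist P Q ^ 2) := by
  have hPs : Summable P := by
    by_contra h
    simp [tsum_eq_zero_of_not_summable h] at hPsum
  have hQs : Summable Q := by
    by_contra h
    simp [tsum_eq_zero_of_not_summable h] at hQsum
  have hP1 : HasSum P 1 := hPsum ▸ hPs.hasSum
  have hQ1 : HasSum Q 1 := hQsum ▸ hQs.hasSum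
  by_cases hdisj : ∀ x, P x = 0 ∨ Q x = 0
  · have htv : tvDist P Q = 1 := by
      have habs (x) : |P x - Q x| = P x + Q x := by
        rcases hdisj x with h | h
        · simp [h, abs_of_nonneg (hQnn x)]
        · simp [h, abs_of_nonneg (hPnn x)]
      simp only [tvDist, habs, (hP1.add hQ1).tsum_eq]
      norm_num
    simp [chernoffInfo, htv, log_tsum_rpow_mul_rpow_eq_zero hPsum hQsum hdisj]
  push Not at hdisj
  obtain ⟨y, hPy, hQy⟩ := hdisj
  have hPy := (hPnn y).lt_of_ne' hPy
  have hQy := (hQnn y).lt_of_ne' hQy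
  have hlow (t : Set.Icc (0 : ℝ) 1) :
      min (P y) (Q y) ≤ ∑' x, P x ^ (t : ℝ) * Q x ^ (1 - (t : ℝ)) :=
    (Real.min_le_rpow_mul_rpow_one_sub hPy hQy t.2.1 t.2.2).trans <|
      (Real.summable_rpow_mul_rpow_one_sub hPnn hQnn hPs hQs t.2.1 t.2.2).le_tsum y fun x _ ↦
        mul_nonneg (Real.rpow_nonneg (hPnn x) _) (Real.rpow_nonneg (hQnn x) _)
  have hm : 0 < min (P y) (Q y) := lt_min hPy hQy
  have hbdd : BddBelow (Set.range fun t : Set.Icc (0 : ℝ) 1 ↦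
      Real.log (∑' x, P x ^ (t : ℝ) * Q x ^ (1 - (t : ℝ)))) :=
    ⟨Real.log (min (P y) (Q y)), by
      rintro _ ⟨t, rfl⟩
      exact Real.log_le_log hm (hlow t)⟩
  have hD : HasSum (fun x ↦ 1 / 2 * |P x - Q x|) (tvDist P Q) :=
    (hPs.sub hQs).abs.hasSum.mul_left _
  have hA : HasSum (fun x ↦ min (P x) (Q x)) (1 - tvDist P Q) := by
    have hterm (x) : min (P x) (Q x) = 1 / 2 * (P x + Q x) - 1 / 2 * |P x - Q x| := by
      rcases le_total (P x) (Q x) with h | h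
      · rw [min_eq_left h, abs_of_nonpos (sub_nonpos.2 h)]
        ring
      · rw [min_eq_right h, abs_of_nonneg (sub_nonneg.2 h)]
        ring
    have htotal : 1 - tvDist P Q = 1 / 2 * (1 + 1) - tvDist P Q := by ring
    simp_rw [hterm]
    rw [htotal]
    exact ((hP1.add hQ1).mul_left (1 / 2)).sub hD
  have hB : HasSum (fun x ↦ max (P x) (Q x)) (1 + tvDist P Q) := by
    have hterm (x) : max (P x) (Q x) = 1 / 2 * (P x + Q x) + 1 / 2 * |P x - Q x| := by
      rcases le_total (P x) (Q x) with h | h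
      · rw [max_eq_right h, abs_of_nonpos (sub_nonpos.2 h)]
        ring
      · rw [max_eq_left h, abs_of_nonneg (sub_nonneg.2 h)]
        ring
    have htotal : 1 + tvDist P Q = 1 / 2 * (1 + 1) + tvDist P Q := by ring
    simp_rw [hterm]
    rw [htotal]
    exact ((hP1.add hQ1).mul_left (1 / 2)).add hD
  have hA0 : 0 < 1 - tvDist P Q :=
    hm.trans_le (le_hasSum hA y fun x _ ↦ le_min (hPnn x) (hQnn x))
  have hB0 : 0 < 1 + tvDist P Q :=
    hPy.trans_le ((le_max_left _ _).trans
      (le_hasSum hB y fun x _ ↦ (hPnn x).trans (le_max_left _ _)))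
  let half : Set.Icc (0 : ℝ) 1 := ⟨1 / 2, by norm_num, by norm_num⟩
  have hinf := ciInf_le hbdd half
  have hlog := Real.log_le_log (hm.trans_le (hlow half))
    (tsum_sqrt_mul_le_sqrt hPnn hQnn hPs hQs hA hB hA0 hB0)
  rw [Real.log_sqrt (mul_pos hA0 hB0).le] at hlog
  have hfactor : 1 - tvDist P Q ^ 2 = (1 - tvDist P Q) * (1 + tvDist P Q) := by ring
  rw [chernoffInfo, hfactor]
  linarith [hinf.trans hlog]
end
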